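/- For every positive integer n, cf(n) ≤ 8·⌈n/41⌉; that is, for every n there exists a set of n points in the plane in general position whose largest crossing family has size at most 8·⌈n/41⌉. -/

import Mathlib

/-- A finite set of points in the plane is in *general position* if no three of
its points are collinear. -/
def GenPos (S : Finset (ℝ × ℝ)) : Prop :=
  ∀ p ∈ S, ∀ q ∈ S, ∀ r ∈ S, p ≠ q → p ≠ r → q ≠ r →
    ¬Collinear ℝ ({p, q, r} : Set (ℝ × ℝ))

/-- Two closed segments `pq` and `rs` *cross* if they intersect in exactly one
point, which lies in the interior of both segments. -/
def Crosses (p q r s : ℝ × ℝ) : Prop :=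
  ∃ x : ℝ × ℝ, x ∈ openSegment ℝ p q ∧ x ∈ openSegment ℝ r s ∧
    segment ℝ p q ∩ segment ℝ r s = {x}

/-- `F` is a *crossing family* in `S`: a finite set of segments (given by their
pairs of distinct endpoints, which belong to `S`) that pairwise cross. -/
def IsCrossingFamily (S : Finset (ℝ × ℝ)) (F : Finset ((ℝ × ℝ) × (ℝ × ℝ))) : Prop :=
  (∀ e ∈ F, e.1 ∈ S ∧ e.2 ∈ S ∧ e.1 ≠ e.2) ∧
  (∀ e ∈ F, ∀ f ∈ F, e ≠ f → Crosses e.1 e.2 f.1 f.2)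

/-- `S` contains a `k`-crossing family. -/
def HasCrossingFamily (S : Finset (ℝ × ℝ)) (k : ℕ) : Prop :=
  ∃ F : Finset ((ℝ × ℝ) × (ℝ × ℝ)), IsCrossingFamily S F ∧ F.card = k

/-- `cf S`: the maximum size of a crossing family in `S`. -/
noncomputable def cf (S : Finset (ℝ × ℝ)) : ℕ :=
  sSup {k : ℕ | HasCrossingFamily S k}

/-- `cfNat n`: the minimum of `cf S` over all sets `S` of `n` points in
general position. -/
noncomputable def cfNat (n : ℕ) : ℕ :=
  sInf {m : ℕ | ∃ S : Finset (ℝ × ℝ), S.card = n ∧ GenPos S ∧ cf S = m}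

namespace CrossingSearch

/-- Evaluates the number `n` before it is passed on to `f`, which keeps kernel terms small. -/
noncomputable def forced {α : Type} (n : ℕ) (f : ℕ → α) : α :=
  Nat.rec (f 0) (fun k _ => f (Nat.succ k)) n

/-- The bit mask of the points of `l` to the left of the line through `(x₁, y₁)` and `(x₂, y₂)`,
where `k₁ = x₁ * y₂` and `k₂ = y₁ * x₂`. -/
noncomputable def lineMask (x₁ y₁ x₂ y₂ k₁ k₂ : ℕ) (l : List (ℕ × ℕ)) : ℕ :=
  List.rec 0 (fun c _ ih => Prod.rec (fun x y =>
    forced ih fun m =>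
      Bool.rec (Nat.add m m) (Nat.succ (Nat.add m m))
        (Nat.blt (Nat.add k₂ (Nat.add (Nat.mul y₂ x) (Nat.mul y x₁)))
          (Nat.add k₁ (Nat.add (Nat.mul x₂ y) (Nat.mul x y₁))))) c) l

/-- The orientations of all triples starting with `(x₁, y₁)`: bit `64 * a + c` is set when point `c`
of `pts` is to the left of the line from `(x₁, y₁)` to point `a` of `l`. -/
noncomputable def rowMask (x₁ y₁ : ℕ) (pts l : List (ℕ × ℕ)) : ℕ :=
  List.rec 0 (fun c _ ih => Prod.rec (fun x y =>
    forced ih fun m => forced (Nat.mul x₁ y) fun k₁ => forced (Nat.mul y₁ x) fun k₂ =>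
      Nat.add (Nat.mul m (2 ^ 64)) (lineMask x₁ y₁ x y k₁ k₂ pts)) c) l

/-- A list of vertices `v`, each with its row `r` of orientations and the bit mask `P` of its
possible partners. -/
inductive Cands where
  | nil
  | cons (v r P : ℕ) (t : Cands)

/-- Splits the edges of `g` that cross the edge `vw` according to the side of their first endpoint.
Here `sv = 64 * v`, `sw = 64 * w`, and `l`, `l'` are the masks of the two sides of `vw`. -/
noncomputable def refineGroup (sv sw l l' : ℕ) (g : Cands) :
    Cands → Cands → (Cands → Cands → Bool) → Bool :=
  Cands.rec (fun u₁ u₂ k => k u₁ u₂)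
    (fun x r P _ ih u₁ u₂ k =>
      Nat.rec
        (Nat.rec (ih u₁ u₂ k) (fun P' _ => ih u₁ (.cons x r (Nat.succ P') u₂) k)
          (Nat.land (Nat.land P l) (Nat.xor (Nat.shiftRight r sv) (Nat.shiftRight r sw))))
        (fun _ _ => Nat.rec (ih u₁ u₂ k) (fun P' _ => ih (.cons x r (Nat.succ P') u₁) u₂ k)
          (Nat.land (Nat.land P l') (Nat.xor (Nat.shiftRight r sv) (Nat.shiftRight r sw))))
        (Nat.land (Nat.shiftRight l x) (nat_lit 1))) g

/-- Adds the group `g` to `gs` unless it is empty. -/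
noncomputable def consNonempty (g : Cands) (gs : List Cands) : List Cands :=
  Cands.rec gs (fun _ _ _ _ _ => g :: gs) g

/-- Applies `refineGroup` to all groups of `gs`. -/
noncomputable def refine (sv sw l l' : ℕ) (gs : List Cands) :
    List Cands → (List Cands → Bool) → Bool :=
  List.rec (fun acc k => k acc)
    (fun g _ ih acc k => refineGroup sv sw l l' g .nil .nil fun u₁ u₂ =>
      ih (consNonempty u₁ (consNonempty u₂ acc)) k) gs

/-- Decreases `need` by the minimum of the length of `g` and the number of bits of the argument
after it; returns `d` as soon as `need` would vanish. -/
noncomputable def countBits (g : Cands) : ℕ → ℕ → (ℕ → Bool) → Bool → Bool :=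
  Cands.rec (fun _ need k _ => k need)
    (fun _ _ _ _ ih U need k d => Nat.rec (k need) (fun U' _ =>
      Nat.rec d (fun need' _ => Nat.rec d (fun _ _ =>
        forced (Nat.xor (Nat.succ U') (Nat.shiftLeft (nat_lit 1) (Nat.log2 (Nat.succ U'))))
          fun U'' => ih U'' need' k d) need') need) U) g

/-- The union of the masks in `g`. -/
noncomputable def scan (g : Cands) : ℕ → (ℕ → Bool) → Bool :=
  Cands.rec (fun U k => k U)
    (fun _ _ P _ ih U k => forced (Nat.lor U P) fun U' => ih U' k) g

/-- Whether the trivial upper bound for a matching in `gs` reaches the given number. -/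
noncomputable def enough (gs : List Cands) : ℕ → Bool :=
  List.rec (fun _ => false)
    (fun g _ ih need => scan g (nat_lit 0) fun U => countBits g U need ih true) gs

/-- The minimum of the masks in `g` and a given number. -/
noncomputable def minMask (g : Cands) : ℕ → (ℕ → Bool) → Bool :=
  Cands.rec (fun m k => k m)
    (fun _ _ P _ ih m k => Bool.rec (ih m k) (ih P k) (Nat.ble P m)) g

/-- The minimum of the masks in `gs` and a given number. -/
noncomputable def minMasks (gs : List Cands) : ℕ → (ℕ → Bool) → Bool :=
  List.rec (fun m k => k m) (fun g _ ih m k => minMask g m fun m' => ih m' k) gs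

/-- Concatenation of groups. -/
noncomputable def append (g h : Cands) : Cands :=
  Cands.rec h (fun x r P _ ih => .cons x r P ih) g

/-- Removes the first element with mask `m` from `g`. -/
noncomputable def takeGroup (m : ℕ) (g : Cands) :
    Cands → (ℕ → ℕ → ℕ → Cands → Bool) → Bool → Bool :=
  Cands.rec (fun _ _ d => d)
    (fun x r P t ih acc k d =>
      Bool.rec (ih (.cons x r P acc) k d) (k x r P (append acc t)) (Nat.beq P m)) g

/-- Removes the first element with mask `m` from the groups `gs`. -/
noncomputable def take (m : ℕ) (gs : List Cands) :
    List Cands → (ℕ → ℕ → ℕ → List Cands → Bool) → Bool → Bool :=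
  List.rec (fun _ _ d => d)
    (fun g t ih acc k d => takeGroup m g .nil
      (fun x r P g' => k x r P (consNonempty g' (List.rec t (fun a _ h => a :: h) acc)))
      (ih (g :: acc) k d)) gs

/-- Runs `f` on the refinements of `gs` by all edges `vw` with `w` in a given mask. -/
noncomputable def branch (f : List Cands → Bool) (sv r : ℕ) (gs : List Cands) (n : ℕ) : ℕ → Bool :=
  Nat.rec (fun _ => false)
    (fun _ ih P => Nat.rec true (fun P' _ =>
      (forced (Nat.log2 (Nat.succ P')) fun w =>
       forced (Nat.mul (nat_lit 64) w) fun sw =>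
       forced (Nat.land (nat_lit 18446744073709551615) (Nat.shiftRight r sw)) fun l =>
       forced (Nat.shiftLeft (nat_lit 1) w) fun bw =>
       forced (Nat.xor (nat_lit 18446744073709551615) (Nat.lor l bw)) fun l' =>
        Bool.rec false (forced (Nat.xor (Nat.succ P') bw) ih) (refine sv sw l l' gs [] f)))
      P) n

/-- Checks that the groups `gs` contain no crossing family of the given size. -/
noncomputable def search (fuel : ℕ) : ℕ → List Cands → Bool :=
  Nat.rec (fun _ _ => false)
    (fun _ ih need gs => Nat.rec false (fun need' _ =>
      Bool.rec true
        (minMasks gs (nat_lit 18446744073709551615) fun m => take m gs []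
          (fun v r P gs' =>
            forced (Nat.mul (nat_lit 64) v) fun sv =>
            Bool.rec false (ih (Nat.succ need') gs')
              (branch (ih need') sv r gs' (nat_lit 64) P)) false)
        (enough gs (Nat.succ need'))) need) fuel

/-- Checks that no `need` pairwise crossing edges of `g` cross an edge `pq` with `q` in `l` and
`64 * p + q` between `lo` and `hi`. Here `r` is the row of `p` and `sv = 64 * p`. -/
noncomputable def rootEdges (r sv need lo hi : ℕ) (g : Cands) (l : Cands) : Bool :=
  Cands.rec true (fun q _ _ _ ih =>
    Bool.rec ih (Bool.rec ih
      (forced (Nat.mul (nat_lit 64) q) fun sw =>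
       forced (Nat.land (nat_lit 18446744073709551615) (Nat.shiftRight r sw)) fun l =>
       forced (Nat.shiftLeft (nat_lit 1) q) fun bw =>
       forced (Nat.xor (nat_lit 18446744073709551615) (Nat.lor l bw)) fun l' =>
        Bool.rec false ih
          (refineGroup sv sw l l' g .nil .nil fun u₁ _ => search (nat_lit 400) need [u₁]))
        (Nat.blt (Nat.add sv q) hi)) (Nat.ble lo (Nat.add sv q))) l

/-- Replaces all masks in `g` by `P`. -/
noncomputable def setMask (P : ℕ) (g : Cands) : Cands → (Cands → Bool) → Bool :=
  Cands.rec (fun acc k => k acc) (fun v r _ _ ih acc k => ih (.cons v r P acc) k) g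

/-- Checks that no `need` pairwise crossing edges cross an edge `pq` with `lo ≤ 64 * p + q < hi`
and have all their endpoints smaller than `p`. -/
noncomputable def roots (need lo hi : ℕ) (pts l : List (ℕ × ℕ)) : ℕ → Cands → Bool :=
  List.rec (fun _ _ => true) (fun c _ ih p g => Prod.rec (fun x y =>
    forced (Nat.mul (nat_lit 64) p) fun sv =>
    Bool.rec true (
    forced (rowMask x y pts pts) fun r =>
    forced (Nat.sub (Nat.shiftLeft (nat_lit 1) p) (nat_lit 1)) fun P =>
    Bool.rec false (forced (Nat.succ p) fun p' => ih p' (.cons p r 0 g))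
      (setMask P g .nil fun g' => rootEdges r sv need lo hi g' g')) (Nat.blt sv hi)) c) l

@[simp]
lemma forced_eq {α : Type} (n : ℕ) (f : ℕ → α) : forced n f = f n := by
  cases n <;> rfl

lemma boolRec_false_eq_true {a b : Bool} (h : (Bool.rec false a b : Bool) = true) :
    b = true ∧ a = true := by
  cases b
  · cases h
  · exact ⟨rfl, h⟩

/-- The vertex `v` is left of the edge from `x` to `y`, in terms of the row of `x`. -/
def side (R : ℕ → ℕ) (x y v : ℕ) : Bool := (R x).testBit (64 * y + v)

/-- The edge `f` crosses the edge `e`, in terms of orientations. -/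
def Compat (R : ℕ → ℕ) (e f : ℕ × ℕ) : Prop :=
  side R e.1 e.2 f.1 ≠ side R e.1 e.2 f.2 ∧ side R f.1 e.1 f.2 ≠ side R f.1 e.2 f.2

/-- The edge `e` is represented by `g`. -/
def Covered (R : ℕ → ℕ) : Cands → ℕ × ℕ → Prop
  | .nil, _ => False
  | .cons x r P t, e => (x = e.1 ∧ r = R e.1 ∧ P.testBit e.2 = true) ∨ Covered R t e

/-- A family of pairwise crossing edges with distinct endpoints. -/
structure IsFamily (R : ℕ → ℕ) (M : Finset (ℕ × ℕ)) : Prop where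
  lt₁ : ∀ e ∈ M, e.1 < 64
  lt₂ : ∀ e ∈ M, e.2 < 64
  inj₁ : ∀ e ∈ M, ∀ f ∈ M, e ≠ f → e.1 ≠ f.1
  inj₂ : ∀ e ∈ M, ∀ f ∈ M, e ≠ f → e.2 ≠ f.2
  compat : ∀ e ∈ M, ∀ f ∈ M, e ≠ f → Compat R e f

lemma IsFamily.mono {R : ℕ → ℕ} {M N : Finset (ℕ × ℕ)} (h : IsFamily R M) (hN : N ⊆ M) :
    IsFamily R N where
  lt₁ e he := h.lt₁ e (hN he)
  lt₂ e he := h.lt₂ e (hN he)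
  inj₁ e he f hf := h.inj₁ e (hN he) f (hN hf)
  inj₂ e he f hf := h.inj₂ e (hN he) f (hN hf)
  compat e he f hf := h.compat e (hN he) f (hN hf)

lemma testBit_all (i : ℕ) : Nat.testBit 18446744073709551615 i = decide (i < 64) := by
  rw [show 18446744073709551615 = 2 ^ 64 - 1 by norm_num, Nat.testBit_two_pow_sub_one]

/-- The mask of the points to the left of the edge `vw`, where `r` is the row of `v`. -/
def leftMask (r w : ℕ) : ℕ := Nat.land 18446744073709551615 (Nat.shiftRight r (Nat.mul 64 w))

/-- The complement of `w` and the points to the left of the edge `vw`. -/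
def rightMask (r w : ℕ) : ℕ :=
  Nat.xor 18446744073709551615 (Nat.lor (leftMask r w) (Nat.shiftLeft 1 w))

lemma testBit_leftMask (R : ℕ → ℕ) (v w : ℕ) {i : ℕ} (hi : i < 64) :
    (leftMask (R v) w).testBit i = side R v w i := by
  change (18446744073709551615 &&& (R v >>> (64 * w))).testBit i = _
  simp [testBit_all, hi, side]

lemma testBit_rightMask (R : ℕ → ℕ) (v w : ℕ) {i : ℕ} (hi : i < 64) (hw : i ≠ w) :
    (rightMask (R v) w).testBit i = !side R v w i := by
  change (18446744073709551615 ^^^ (leftMask (R v) w ||| 1 <<< w)).testBit i = _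
  rw [Nat.testBit_xor, Nat.testBit_or, testBit_leftMask R v w hi, testBit_all,
    Nat.one_shiftLeft, Nat.testBit_two_pow_of_ne hw.symm]
  simp [hi]

lemma refineGroup_spec (R : ℕ → ℕ) (v w : ℕ) (g : Cands) : ∀ u₁ u₂ : Cands, ∃ o₁ o₂ : Cands,
    (∀ k, refineGroup (Nat.mul 64 v) (Nat.mul 64 w) (leftMask (R v) w) (rightMask (R v) w)
      g u₁ u₂ k = k o₁ o₂) ∧
    (∀ e, Covered R u₁ e → Covered R o₁ e) ∧ (∀ e, Covered R u₂ e → Covered R o₂ e) ∧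
    ∀ e, Covered R g e → e.1 < 64 → e.2 < 64 → e.2 ≠ w → Compat R (v, w) e →
      if side R v w e.1 then Covered R o₁ e else Covered R o₂ e := by
  induction g with
  | nil => exact fun u₁ u₂ => ⟨u₁, u₂, fun k => rfl, fun e h => h, fun e h => h, fun e h => h.elim⟩
  | cons x r P t ih =>
    intro u₁ u₂
    obtain ⟨b, hb⟩ : ∃ b, b = Nat.land (Nat.shiftRight (leftMask (R v) w) x) 1 := ⟨_, rfl⟩
    obtain ⟨X, hX⟩ : ∃ X, X = Nat.xor (Nat.shiftRight r (Nat.mul 64 v))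
      (Nat.shiftRight r (Nat.mul 64 w)) := ⟨_, rfl⟩
    obtain ⟨A, hA⟩ : ∃ A, A = Nat.land (Nat.land P (leftMask (R v) w)) X := ⟨_, rfl⟩
    obtain ⟨B, hB⟩ : ∃ B, B = Nat.land (Nat.land P (rightMask (R v) w)) X := ⟨_, rfl⟩
    have hb' : ∀ e : ℕ × ℕ, x = e.1 → e.1 < 64 → (side R v w e.1 = true ↔ b ≠ 0) := by
      rintro e rfl h1
      rw [← testBit_leftMask R v w h1, Nat.testBit, hb]
      change _ ↔ (leftMask (R v) w >>> e.1) &&& 1 ≠ 0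
      rw [Nat.and_comm 1]
      simp
    have hbit : ∀ e : ℕ × ℕ, x = e.1 → r = R e.1 → P.testBit e.2 = true → Compat R (v, w) e →
        e.1 < 64 → e.2 < 64 → e.2 ≠ w →
        (side R v w e.1 = false → A.testBit e.2 = true) ∧
        (side R v w e.1 = true → B.testBit e.2 = true) := by
      rintro e rfl rfl hP hc h1 h2 h3
      have hXe : X.testBit e.2 = true := by
        rw [hX]
        change ((R e.1 >>> (64 * v)) ^^^ (R e.1 >>> (64 * w))).testBit e.2 = true
        have := hc.2
        simp only [side] at this
        simpa [Nat.testBit_xor, Nat.testBit_shiftRight] using this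
      have hc1 := hc.1
      constructor
      · intro h
        rw [hA]
        change ((P &&& leftMask (R v) w) &&& X).testBit e.2 = true
        simp only [Nat.testBit_and, hP, hXe, testBit_leftMask R v w h2]
        simp only [h] at hc1
        simpa using hc1.symm
      · intro h
        rw [hB]
        change ((P &&& rightMask (R v) w) &&& X).testBit e.2 = true
        simp only [Nat.testBit_and, hP, hXe, testBit_rightMask R v w h2 h3]
        simp only [h] at hc1
        simpa using hc1.symm
    have step : ∀ k, refineGroup (Nat.mul 64 v) (Nat.mul 64 w) (leftMask (R v) w)
        (rightMask (R v) w) (.cons x r P t) u₁ u₂ k = 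
      Nat.rec
        (Nat.rec (refineGroup (Nat.mul 64 v) (Nat.mul 64 w) (leftMask (R v) w)
          (rightMask (R v) w) t u₁ u₂ k) (fun P' _ => refineGroup (Nat.mul 64 v) (Nat.mul 64 w)
            (leftMask (R v) w) (rightMask (R v) w) t u₁ (.cons x r (Nat.succ P') u₂) k) A)
        (fun _ _ => Nat.rec (refineGroup (Nat.mul 64 v) (Nat.mul 64 w) (leftMask (R v) w)
          (rightMask (R v) w) t u₁ u₂ k) (fun P' _ => refineGroup (Nat.mul 64 v) (Nat.mul 64 w)
            (leftMask (R v) w) (rightMask (R v) w) t (.cons x r (Nat.succ P') u₁) u₂ k) B) b := by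
      intro k
      rw [hb, hA, hB, hX]
      rfl
    clear hb hX hA hB
    have trivial_case : ((∀ e : ℕ × ℕ, x = e.1 → r = R e.1 → P.testBit e.2 = true →
        e.1 < 64 → e.2 < 64 → e.2 ≠ w → Compat R (v, w) e → False)) →
        (∀ k, refineGroup (Nat.mul 64 v) (Nat.mul 64 w) (leftMask (R v) w)
        (rightMask (R v) w) (.cons x r P t) u₁ u₂ k = refineGroup (Nat.mul 64 v) (Nat.mul 64 w)
          (leftMask (R v) w) (rightMask (R v) w) t u₁ u₂ k) → ∃ o₁ o₂ : Cands,
    (∀ k, refineGroup (Nat.mul 64 v) (Nat.mul 64 w) (leftMask (R v) w) (rightMask (R v) w)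
      (.cons x r P t) u₁ u₂ k = k o₁ o₂) ∧
    (∀ e, Covered R u₁ e → Covered R o₁ e) ∧ (∀ e, Covered R u₂ e → Covered R o₂ e) ∧
    ∀ e, Covered R (.cons x r P t) e → e.1 < 64 → e.2 < 64 → e.2 ≠ w → Compat R (v, w) e →
      if side R v w e.1 then Covered R o₁ e else Covered R o₂ e := by
      intro h hk
      obtain ⟨o₁, o₂, h1, h2, h3, h4⟩ := ih u₁ u₂
      refine ⟨o₁, o₂, fun k => (hk k).trans (h1 k), h2, h3, fun e he h5 h6 h7 h8 => ?_⟩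
      rcases he with ⟨hx, hr, hP⟩ | he
      · exact (h e hx hr hP h5 h6 h7 h8).elim
      · exact h4 e he h5 h6 h7 h8
    rcases b with _ | b
    · rcases A with _ | A
      · refine trivial_case (fun e hx hr hP h5 h6 h7 h8 => ?_) step
        have h9 := (hbit e hx hr hP h8 h5 h6 h7).1 (by simpa using (hb' e hx h5).not)
        simp at h9
      · obtain ⟨o₁, o₂, h1, h2, h3, h4⟩ := ih u₁ (.cons x r (A + 1) u₂)
        refine ⟨o₁, o₂, fun k => (step k).trans (h1 k), h2, fun e he => h3 e (Or.inr he),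
          fun e he h5 h6 h7 h8 => ?_⟩
        rcases he with ⟨hx, hr, hP⟩ | he
        · have h10 : side R v w e.1 = false := by simpa using (hb' e hx h5).not
          simpa [h10] using h3 e (Or.inl ⟨hx, hr, (hbit e hx hr hP h8 h5 h6 h7).1 h10⟩)
        · exact h4 e he h5 h6 h7 h8
    · rcases B with _ | B
      · refine trivial_case (fun e hx hr hP h5 h6 h7 h8 => ?_) step
        have h9 := (hbit e hx hr hP h8 h5 h6 h7).2 (by simpa using hb' e hx h5)
        simp at h9
      · obtain ⟨o₁, o₂, h1, h2, h3, h4⟩ := ih (.cons x r (B + 1) u₁) u₂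
        refine ⟨o₁, o₂, fun k => (step k).trans (h1 k), fun e he => h2 e (Or.inr he), h3,
          fun e he h5 h6 h7 h8 => ?_⟩
        rcases he with ⟨hx, hr, hP⟩ | he
        · have h10 : side R v w e.1 = true := by simpa using hb' e hx h5
          simpa [h10] using h2 e (Or.inl ⟨hx, hr, (hbit e hx hr hP h8 h5 h6 h7).2 h10⟩)
        · exact h4 e he h5 h6 h7 h8

/-- The edge `e` is represented by one of the groups `gs`. -/
def CoveredBy (R : ℕ → ℕ) (gs : List Cands) (e : ℕ × ℕ) : Prop := ∃ g ∈ gs, Covered R g e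

lemma coveredBy_cons {R : ℕ → ℕ} {g : Cands} {gs : List Cands} {e : ℕ × ℕ} :
    CoveredBy R (g :: gs) e ↔ Covered R g e ∨ CoveredBy R gs e := by
  simp [CoveredBy]

lemma coveredBy_consNonempty {R : ℕ → ℕ} {g : Cands} {gs : List Cands} {e : ℕ × ℕ} :
    CoveredBy R (consNonempty g gs) e ↔ Covered R g e ∨ CoveredBy R gs e := by
  cases g with
  | nil => simp [consNonempty, Covered]
  | cons v r P t => exact coveredBy_cons

lemma refine_spec (R : ℕ → ℕ) (v w : ℕ) (gs : List Cands) : ∀ acc : List Cands, ∃ hs : List Cands,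
    (∀ k, refine (Nat.mul 64 v) (Nat.mul 64 w) (leftMask (R v) w) (rightMask (R v) w)
      gs acc k = k hs) ∧
    (∀ e, CoveredBy R acc e → CoveredBy R hs e) ∧
    ∀ e, CoveredBy R gs e → e.1 < 64 → e.2 < 64 → e.2 ≠ w → Compat R (v, w) e →
      CoveredBy R hs e := by
  induction gs with
  | nil => exact fun acc => ⟨acc, fun k => rfl, fun e h => h, fun e h => by simp [CoveredBy] at h⟩
  | cons g gs ih =>
    intro acc
    obtain ⟨o₁, o₂, h1, -, -, h4⟩ := refineGroup_spec R v w g .nil .nil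
    obtain ⟨hs, h5, h6, h7⟩ := ih (consNonempty o₁ (consNonempty o₂ acc))
    refine ⟨hs, fun k => (h1 _).trans (h5 k),
      fun e he => h6 e (by simp [coveredBy_consNonempty, he]), fun e he a1 a2 a3 a4 => ?_⟩
    rcases coveredBy_cons.1 he with he | he
    · have := h4 e he a1 a2 a3 a4
      apply h6
      rw [coveredBy_consNonempty, coveredBy_consNonempty]
      split_ifs at this
      · exact Or.inl this
      · exact Or.inr (Or.inl this)
    · exact h7 e he a1 a2 a3 a4

/-- The number of elements of a group. -/
def length : Cands → ℕ
  | .nil => 0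
  | .cons _ _ _ t => length t + 1

/-- The vertices of a group. -/
def vertices : Cands → Finset ℕ
  | .nil => ∅
  | .cons v _ _ t => insert v (vertices t)

lemma card_vertices_le (g : Cands) : (vertices g).card ≤ length g := by
  induction g with
  | nil => simp [vertices]
  | cons v r P t ih => exact (Finset.card_insert_le _ _).trans (Nat.succ_le_succ ih)

lemma Covered.mem_vertices {R : ℕ → ℕ} {g : Cands} {e : ℕ × ℕ} (h : Covered R g e) :
    e.1 ∈ vertices g := by
  induction g with
  | nil => exact h.elim
  | cons v r P t ih =>
    rcases h with ⟨rfl, -, -⟩ | h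
    · exact Finset.mem_insert_self _ _
    · exact Finset.mem_insert_of_mem (ih h)

lemma scan_spec (R : ℕ → ℕ) (g : Cands) : ∀ U : ℕ, ∃ V : ℕ, (∀ k, scan g U k = k V) ∧
    (∀ i, U.testBit i = true → V.testBit i = true) ∧
    ∀ e, Covered R g e → V.testBit e.2 = true := by
  induction g with
  | nil => exact fun U => ⟨U, fun k => rfl, fun i h => h, fun e h => h.elim⟩
  | cons v r P t ih =>
    intro U
    obtain ⟨V, h1, h2, h3⟩ := ih (U ||| P)
    refine ⟨V, fun k => (forced_eq (U ||| P) fun V => scan t V k).trans (h1 k),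
      fun i hi => h2 i (by simp [hi]), ?_⟩
    rintro e (⟨-, -, hP⟩ | he)
    · exact h2 _ (by simp [hP])
    · exact h3 e he

/-- Removing the leading bit of a number. -/
lemma testBit_xor_log2 {n i : ℕ} (h : i ≠ n.log2) :
    (Nat.xor n (Nat.shiftLeft 1 n.log2)).testBit i = n.testBit i := by
  change (n ^^^ (1 <<< n.log2)).testBit i = _
  simp [Nat.testBit_xor, Nat.one_shiftLeft, Nat.testBit_two_pow_of_ne h.symm]

lemma countBits_spec (g : Cands) : ∀ (U need : ℕ) (k : ℕ → Bool), 0 < need →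
    countBits g U need k true = false → ∃ m < need, k (need - m) = false ∧
      (m = length g ∨ ∀ T : Finset ℕ, (∀ i ∈ T, U.testBit i = true) → T.card ≤ m) := by
  induction g with
  | nil => exact fun U need k hn h => ⟨0, hn, h, Or.inl rfl⟩
  | cons v r P t ih =>
    intro U need k hn h
    rcases U with _ | U
    · refine ⟨0, hn, h, Or.inr fun T hT => ?_⟩
      rw [Finset.eq_empty_of_forall_notMem (s := T) fun i hi => by simpa using hT i hi]
      simp
    rcases need with _ | _ | need
    · cases h
    · cases h
    have h' : countBits t (Nat.xor (U + 1) (Nat.shiftLeft 1 (Nat.log2 (U + 1)))) (need + 1) k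
        true = false := by
      rw [← h]
      exact (forced_eq _ (fun U'' => countBits t U'' (need + 1) k true)).symm
    obtain ⟨m, h1, h2, h3⟩ := ih _ _ _ (Nat.succ_pos _) h'
    refine ⟨m + 1, by omega, by rwa [show need + 1 + 1 - (m + 1) = need + 1 - m by omega], ?_⟩
    refine h3.imp (fun h => by simp [length, h]) fun h T hT => ?_
    have := h (T.erase (Nat.log2 (U + 1))) fun i hi => by
      rw [testBit_xor_log2 (Finset.ne_of_mem_erase hi)]
      exact hT i (Finset.mem_of_mem_erase hi)
    have := Finset.pred_card_le_card_erase (s := T) (a := Nat.log2 (U + 1))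
    omega

lemma enough_spec {R : ℕ → ℕ} (gs : List Cands) : ∀ need : ℕ, 0 < need → enough gs need = false →
    ∀ M, IsFamily R M → (∀ e ∈ M, CoveredBy R gs e) → M.card < need := by
  classical
  induction gs with
  | nil =>
    intro need hn _ M _ hM
    rw [Finset.eq_empty_of_forall_notMem (s := M) fun e he => by simpa [CoveredBy] using hM e he]
    simpa using hn
  | cons g gs ih =>
    intro need hn h M hfam hM
    obtain ⟨V, h1, -, h3⟩ := scan_spec R g 0
    obtain ⟨m, hm, h4, h5⟩ := countBits_spec g V need (enough gs) hn ((h1 _).symm.trans h)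
    have hrest := ih _ (by omega) h4 (M.filter fun e => ¬Covered R g e)
      (hfam.mono (Finset.filter_subset _ _)) fun e he => by
        rw [Finset.mem_filter] at he
        exact (coveredBy_cons.1 (hM e he.1)).resolve_left he.2
    have hcov : (M.filter fun e => Covered R g e).card ≤ m := by
      rcases h5 with rfl | h5
      · rw [← Finset.card_image_of_injOn (f := Prod.fst)]
        · refine (Finset.card_le_card ?_).trans (card_vertices_le g)
          intro i hi
          obtain ⟨e, he, rfl⟩ := Finset.mem_image.1 hi
          exact (Finset.mem_filter.1 he).2.mem_vertices
        · intro e he f hf hef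
          by_contra hne
          exact hfam.inj₁ e (Finset.mem_filter.1 he).1 f (Finset.mem_filter.1 hf).1 hne hef
      · rw [← Finset.card_image_of_injOn (f := Prod.snd)]
        · apply h5
          intro i hi
          obtain ⟨e, he, rfl⟩ := Finset.mem_image.1 hi
          exact h3 e (Finset.mem_filter.1 he).2
        · intro e he f hf hef
          by_contra hne
          exact hfam.inj₂ e (Finset.mem_filter.1 he).1 f (Finset.mem_filter.1 hf).1 hne hef
    have := Finset.card_filter_add_card_filter_not (s := M) (fun e => Covered R g e)
    omega

lemma minMask_spec (g : Cands) : ∀ m : ℕ, ∃ m', ∀ k, minMask g m k = k m' := by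
  induction g with
  | nil => exact fun m => ⟨m, fun k => rfl⟩
  | cons v r P t ih =>
    intro m
    have step : ∀ k, minMask (.cons v r P t) m k =
      Bool.rec (minMask t m k) (minMask t P k) (Nat.ble P m) := fun k => rfl
    cases h : Nat.ble P m <;> simp only [h] at step
    · obtain ⟨m', h'⟩ := ih m
      exact ⟨m', fun k => (step k).trans (h' k)⟩
    · obtain ⟨m', h'⟩ := ih P
      exact ⟨m', fun k => (step k).trans (h' k)⟩

lemma minMasks_spec (gs : List Cands) : ∀ m : ℕ, ∃ m', ∀ k, minMasks gs m k = k m' := by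
  induction gs with
  | nil => exact fun m => ⟨m, fun k => rfl⟩
  | cons g gs ih =>
    intro m
    obtain ⟨m₁, h₁⟩ := minMask_spec g m
    obtain ⟨m₂, h₂⟩ := ih m₁
    exact ⟨m₂, fun k => (h₁ _).trans (h₂ k)⟩

lemma covered_append {R : ℕ → ℕ} {g h : Cands} {e : ℕ × ℕ} :
    Covered R (append g h) e ↔ Covered R g e ∨ Covered R h e := by
  induction g with
  | nil => exact ⟨Or.inr, fun h => h.elim False.elim id⟩
  | cons v r P t ih =>
    change _ ∨ Covered R (append t h) e ↔ (_ ∨ _) ∨ _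
    rw [ih, or_assoc]

lemma takeGroup_spec (R : ℕ → ℕ) (m : ℕ) (g : Cands) : ∀ acc : Cands,
    (∀ k d, takeGroup m g acc k d = d) ∨
    ∃ v r P g', (∀ k d, takeGroup m g acc k d = k v r P g') ∧
      ∀ e, Covered R g e ∨ Covered R acc e →
        (v = e.1 ∧ r = R e.1 ∧ P.testBit e.2 = true) ∨ Covered R g' e := by
  induction g with
  | nil => exact fun acc => Or.inl fun k d => rfl
  | cons v r P t ih =>
    intro acc
    have step : ∀ k d, takeGroup m (.cons v r P t) acc k d =
      Bool.rec (takeGroup m t (.cons v r P acc) k d) (k v r P (append acc t)) (Nat.beq P m) :=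
      fun k d => rfl
    cases h : Nat.beq P m <;> simp only [h] at step
    · refine (ih (.cons v r P acc)).imp (fun h k d => (step k d).trans (h k d)) ?_
      rintro ⟨v', r', P', g', h1, h2⟩
      refine ⟨v', r', P', g', fun k d => (step k d).trans (h1 k d), fun e he => h2 e ?_⟩
      change _ ∨ (_ ∨ _)
      rcases he with (he | he) | he
      · exact Or.inr (Or.inl he)
      · exact Or.inl he
      · exact Or.inr (Or.inr he)
    · refine Or.inr ⟨v, r, P, _, step, fun e he => ?_⟩
      rw [covered_append]
      rcases he with (he | he) | he
      · exact Or.inl he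
      · exact Or.inr (Or.inr he)
      · exact Or.inr (Or.inl he)

lemma take_spec (R : ℕ → ℕ) (m : ℕ) (gs : List Cands) : ∀ acc : List Cands,
    (∀ k d, take m gs acc k d = d) ∨
    ∃ v r P gs', (∀ k d, take m gs acc k d = k v r P gs') ∧
      ∀ e, CoveredBy R gs e ∨ CoveredBy R acc e →
        (v = e.1 ∧ r = R e.1 ∧ P.testBit e.2 = true) ∨ CoveredBy R gs' e := by
  induction gs with
  | nil => exact fun acc => Or.inl fun k d => rfl
  | cons g gs ih =>
    intro acc
    rcases takeGroup_spec R m g .nil with h | ⟨v, r, P, g', h1, h2⟩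
    · have step : ∀ k d, take m (g :: gs) acc k d = take m gs (g :: acc) k d := fun k d => h _ _
      refine (ih (g :: acc)).imp (fun h k d => (step k d).trans (h k d)) ?_
      rintro ⟨v', r', P', gs', h1, h2⟩
      refine ⟨v', r', P', gs', fun k d => (step k d).trans (h1 k d), fun e he => h2 e ?_⟩
      rw [coveredBy_cons] at he ⊢
      tauto
    · refine Or.inr ⟨v, r, P, _, fun k d => h1 _ _, fun e he => ?_⟩
      have happ : ∀ l : List Cands,
          (List.rec gs (fun a _ h => a :: h) l : List Cands) = l ++ gs := by
        intro l
        induction l with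
        | nil => rfl
        | cons a l ih => exact congrArg (a :: ·) ih
      rw [coveredBy_consNonempty, happ]
      have : CoveredBy R (acc ++ gs) e ↔ CoveredBy R acc e ∨ CoveredBy R gs e := by
        simp [CoveredBy, or_and_right, exists_or]
      rw [this]
      rw [coveredBy_cons] at he
      rcases he with (he | he) | he
      · exact (h2 e (Or.inl he)).imp_right Or.inl
      · exact Or.inr (Or.inr (Or.inr he))
      · exact Or.inr (Or.inr (Or.inl he))

lemma branch_spec (f : List Cands → Bool) (v r : ℕ) (gs : List Cands) (n : ℕ) : ∀ P : ℕ,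
    branch f (Nat.mul 64 v) r gs n P = true → ∀ w, P.testBit w = true →
      refine (Nat.mul 64 v) (Nat.mul 64 w) (leftMask r w) (rightMask r w) gs [] f = true := by
  induction n with
  | zero => intro P h; cases h
  | succ n ih =>
    intro P h w hw
    rcases P with _ | P
    · simp at hw
    have step : branch f (Nat.mul 64 v) r gs (n + 1) (P + 1) =
      Bool.rec false (branch f (Nat.mul 64 v) r gs n
        (Nat.xor (P + 1) (Nat.shiftLeft 1 (Nat.log2 (P + 1)))))
        (refine (Nat.mul 64 v) (Nat.mul 64 (Nat.log2 (P + 1))) (leftMask r (Nat.log2 (P + 1)))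
          (rightMask r (Nat.log2 (P + 1))) gs [] f) := by
      change (forced (Nat.log2 (P + 1)) fun w => forced (Nat.mul 64 w) fun sw =>
        forced (Nat.land 18446744073709551615 (Nat.shiftRight r sw)) fun l =>
        forced (Nat.shiftLeft 1 w) fun bw =>
        forced (Nat.xor 18446744073709551615 (Nat.lor l bw)) fun l' =>
          (Bool.rec false (forced (Nat.xor (P + 1) bw) (branch f (Nat.mul 64 v) r gs n))
            (refine (Nat.mul 64 v) sw l l' gs [] f) : Bool)) = _
      simp only [forced_eq]
      rfl
    obtain ⟨h1, h2⟩ := boolRec_false_eq_true (step.symm.trans h)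
    by_cases hw' : w = Nat.log2 (P + 1)
    · rw [hw']
      exact h1
    · exact ih _ h2 w (by rwa [testBit_xor_log2 hw'])

theorem search_sound {R : ℕ → ℕ} (fuel : ℕ) : ∀ (need : ℕ) (gs : List Cands),
    search fuel need gs = true → ∀ M, IsFamily R M → (∀ e ∈ M, CoveredBy R gs e) →
      M.card < need := by
  classical
  induction fuel with
  | zero => intro need gs h; cases h
  | succ fuel ih =>
    intro need gs h M hfam hM
    rcases need with _ | need
    · cases h
    cases hen : enough gs (need + 1)
    · exact enough_spec gs _ (Nat.succ_pos _) hen M hfam hM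
    obtain ⟨m, hm⟩ := minMasks_spec gs 18446744073709551615
    have step : search (fuel + 1) (need + 1) gs = take m gs []
          (fun v r P gs' =>
            forced (Nat.mul 64 v) fun sv =>
            Bool.rec false (search fuel (need + 1) gs')
              (branch (search fuel need) sv r gs' 64 P)) false := by
      rw [← hm (fun m => take m gs [] (fun v r P gs' =>
            forced (Nat.mul 64 v) fun sv =>
            Bool.rec false (search fuel (need + 1) gs')
              (branch (search fuel need) sv r gs' 64 P)) false)]
      change (Bool.rec _ _ (enough gs (need + 1)) : Bool) = _
      rw [hen]
      rfl
    rcases take_spec R m gs [] with h' | ⟨v, r, P, gs', h1, h2⟩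
    · rw [step, h'] at h
      cases h
    rw [step, h1, forced_eq] at h
    obtain ⟨h3, h4⟩ := boolRec_false_eq_true h
    by_cases hp : ∃ e ∈ M, v = e.1 ∧ r = R e.1 ∧ P.testBit e.2 = true
    · obtain ⟨e, heM, rfl, rfl, hP⟩ := hp
      have h5 := branch_spec _ _ _ _ _ _ h3 _ hP
      obtain ⟨hs, h6, -, h7⟩ := refine_spec R e.1 e.2 gs' []
      rw [h6] at h5
      have := ih need hs h5 (M.erase e) (hfam.mono (Finset.erase_subset _ _)) fun f hf => by
        obtain ⟨hne, hfM⟩ := Finset.mem_erase.1 hf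
        refine h7 f ((h2 f (Or.inl (hM f hfM))).resolve_left fun h => ?_) (hfam.lt₁ f hfM)
          (hfam.lt₂ f hfM) (hfam.inj₂ f hfM e heM hne) (hfam.compat e heM f hfM hne.symm)
        exact hfam.inj₁ e heM f hfM hne.symm h.1
      rw [Finset.card_erase_of_mem heM] at this
      omega
    · refine ih _ _ h4 M hfam fun e he => (h2 e (Or.inl (hM e he))).resolve_left fun h => ?_
      exact hp ⟨e, he, h⟩

/-- The points `p`, `a`, `c` are in counterclockwise order. -/
def ccw (p a c : ℕ × ℕ) : Bool :=
  Nat.blt (p.2 * a.1 + (a.2 * c.1 + c.2 * p.1)) (p.1 * a.2 + (a.1 * c.2 + c.1 * p.2))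

lemma testBit_lineMask (p a : ℕ × ℕ) (l : List (ℕ × ℕ)) : ∀ c : ℕ,
    (lineMask p.1 p.2 a.1 a.2 (p.1 * a.2) (p.2 * a.1) l).testBit c = l[c]?.any (ccw p a) := by
  induction l with
  | nil => intro c; simp [lineMask]
  | cons q l ih =>
    have step : lineMask p.1 p.2 a.1 a.2 (p.1 * a.2) (p.2 * a.1) (q :: l) =
        (ccw p a q).toNat + 2 * lineMask p.1 p.2 a.1 a.2 (p.1 * a.2) (p.2 * a.1) l := by
      obtain ⟨M, hM⟩ : ∃ M, M = lineMask p.1 p.2 a.1 a.2 (p.1 * a.2) (p.2 * a.1) l := ⟨_, rfl⟩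
      have : lineMask p.1 p.2 a.1 a.2 (p.1 * a.2) (p.2 * a.1) (q :: l) = forced M fun m =>
          Bool.rec (m + m) (m + m + 1) (ccw p a q) := by rw [hM]; rfl
      rw [this, forced_eq, ← hM]
      cases ccw p a q
      · change M + M = 0 + 2 * M
        omega
      · change M + M + 1 = 1 + 2 * M
        omega
    intro c
    rw [step]
    rcases c with _ | c
    · cases h : ccw p a q <;> simp [h, Nat.testBit_zero]
    · rw [Nat.testBit_succ]
      have : ((ccw p a q).toNat +
          2 * lineMask p.1 p.2 a.1 a.2 (p.1 * a.2) (p.2 * a.1) l) / 2 =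
          lineMask p.1 p.2 a.1 a.2 (p.1 * a.2) (p.2 * a.1) l := by
        have := (ccw p a q).toNat_le
        omega
      rw [this, ih]
      simp

lemma testBit_rowMask (p : ℕ × ℕ) (pts : List (ℕ × ℕ)) (hpts : pts.length ≤ 64)
    (l : List (ℕ × ℕ)) : ∀ a c : ℕ, c < 64 →
    (rowMask p.1 p.2 pts l).testBit (64 * a + c) =
      l[a]?.any fun q => pts[c]?.any (ccw p q) := by
  induction l with
  | nil => intro a c _; simp [rowMask]
  | cons q l ih =>
    intro a c hc
    have step : rowMask p.1 p.2 pts (q :: l) = 2 ^ 64 * rowMask p.1 p.2 pts l +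
        lineMask p.1 p.2 q.1 q.2 (p.1 * q.2) (p.2 * q.1) pts := by
      change (forced (rowMask p.1 p.2 pts l) fun m => forced (p.1 * q.2) fun k₁ =>
        forced (p.2 * q.1) fun k₂ => m * 2 ^ 64 + lineMask p.1 p.2 q.1 q.2 k₁ k₂ pts) = _
      simp only [forced_eq, mul_comm]
    have hlt : lineMask p.1 p.2 q.1 q.2 (p.1 * q.2) (p.2 * q.1) pts < 2 ^ 64 := by
      refine Nat.lt_pow_two_of_testBit _ fun i hi => ?_
      rw [testBit_lineMask, List.getElem?_eq_none (by omega)]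
      rfl
    rw [step, Nat.testBit_two_pow_mul_add _ hlt]
    rcases a with _ | a
    · simp [hc, testBit_lineMask]
    · rw [if_neg (by omega), show 64 * (a + 1) + c - 64 = 64 * a + c by omega, ih a c hc]
      simp

/-- The point with index `i`. -/
def point (pts : List (ℕ × ℕ)) (i : ℕ) : ℕ × ℕ := pts.getD i (0, 0)

/-- The row of the vertex with index `i`. -/
noncomputable def row (pts : List (ℕ × ℕ)) (i : ℕ) : ℕ :=
  rowMask (point pts i).1 (point pts i).2 pts pts

lemma side_row {pts : List (ℕ × ℕ)} (hpts : pts.length ≤ 64) (p : ℕ) {a c : ℕ}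
    (ha : a < pts.length) (hc : c < pts.length) :
    side (row pts) p a c = ccw (point pts p) (point pts a) (point pts c) := by
  rw [side, row, testBit_rowMask _ _ hpts _ _ _ (by omega)]
  simp [point, ha, hc]

/-- The vertex `i` appears in `g` with its row. -/
def HasRow (R : ℕ → ℕ) : Cands → ℕ → Prop
  | .nil, _ => False
  | .cons x r _ t, i => (x = i ∧ r = R i) ∨ HasRow R t i

lemma setMask_spec (R : ℕ → ℕ) (P : ℕ) (g : Cands) : ∀ acc : Cands, ∃ g',
    (∀ k, setMask P g acc k = k g') ∧
    (∀ i, HasRow R g i ∨ HasRow R acc i → HasRow R g' i) ∧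
    (∀ e, Covered R acc e → Covered R g' e) ∧
    ∀ i j, HasRow R g i → P.testBit j = true → Covered R g' (i, j) := by
  induction g with
  | nil =>
    exact fun acc => ⟨acc, fun k => rfl, fun i h => h.elim False.elim id, fun e h => h,
      fun i j h => h.elim⟩
  | cons v r P₀ t ih =>
    intro acc
    obtain ⟨g', h1, h2, h3, h4⟩ := ih (.cons v r P acc)
    refine ⟨g', h1, fun i hi => h2 i ?_, fun e he => h3 e (Or.inr he), fun i j hi hj => ?_⟩
    · rcases hi with (hi | hi) | hi
      · exact Or.inr (Or.inl hi)
      · exact Or.inl hi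
      · exact Or.inr (Or.inr hi)
    · rcases hi with ⟨h5, h6⟩ | hi
      · exact h3 _ (Or.inl ⟨h5, h6, hj⟩)
      · exact h4 i j hi hj

lemma rootEdges_spec {R : ℕ → ℕ} {r p need lo hi : ℕ} {g : Cands} (l : Cands)
    (h : rootEdges r (Nat.mul 64 p) need lo hi g l = true) {q : ℕ} (hq : HasRow R l q)
    (hlo : lo ≤ 64 * p + q) (hhi : 64 * p + q < hi) :
    refineGroup (Nat.mul 64 p) (Nat.mul 64 q) (leftMask r q) (rightMask r q) g .nil .nil
      (fun u₁ _ => search 400 need [u₁]) = true := by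
  induction l with
  | nil => exact hq.elim
  | cons v r' P t ih =>
    have step : rootEdges r (Nat.mul 64 p) need lo hi g (.cons v r' P t) =
      Bool.rec (rootEdges r (Nat.mul 64 p) need lo hi g t)
        (Bool.rec (rootEdges r (Nat.mul 64 p) need lo hi g t)
          (Bool.rec false (rootEdges r (Nat.mul 64 p) need lo hi g t)
            (refineGroup (Nat.mul 64 p) (Nat.mul 64 v) (leftMask r v) (rightMask r v) g .nil .nil
              fun u₁ _ => search 400 need [u₁]))
          (Nat.blt (64 * p + v) hi)) (Nat.ble lo (64 * p + v)) := by
      have : rootEdges r (Nat.mul 64 p) need lo hi g (.cons v r' P t) =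
        Bool.rec (rootEdges r (Nat.mul 64 p) need lo hi g t)
          (Bool.rec (rootEdges r (Nat.mul 64 p) need lo hi g t)
            (forced (Nat.mul 64 v) fun sw =>
              forced (Nat.land 18446744073709551615 (Nat.shiftRight r sw)) fun l =>
              forced (Nat.shiftLeft 1 v) fun bw =>
              forced (Nat.xor 18446744073709551615 (Nat.lor l bw)) fun l' =>
                (Bool.rec false (rootEdges r (Nat.mul 64 p) need lo hi g t)
                  (refineGroup (Nat.mul 64 p) sw l l' g .nil .nil
                    fun u₁ _ => search 400 need [u₁]) : Bool))
          (Nat.blt (64 * p + v) hi)) (Nat.ble lo (64 * p + v)) := rfl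
      rw [this]
      simp only [forced_eq]
      rfl
    rw [step] at h
    rcases hq with ⟨rfl, -⟩ | hq
    · rw [Nat.ble_eq.mpr hlo, Nat.blt_eq.mpr hhi] at h
      exact (boolRec_false_eq_true h).1
    · refine ih ?_ hq
      cases h1 : Nat.ble lo (64 * p + v) <;> rw [h1] at h
      · exact h
      cases h2 : Nat.blt (64 * p + v) hi <;> rw [h2] at h
      · exact h
      · exact (boolRec_false_eq_true h).2

lemma roots_spec {need lo hi : ℕ} {pts : List (ℕ × ℕ)} (l : List (ℕ × ℕ)) : ∀ (p : ℕ) (g : Cands),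
    l = pts.drop p → (∀ i < p, HasRow (row pts) g i) → roots need lo hi pts l p g = true →
    ∀ p', p ≤ p' → p' < pts.length → 64 * p' < hi → ∃ g',
      (∀ i < p', HasRow (row pts) g' i) ∧ (∀ i < p', ∀ j < p', Covered (row pts) g' (i, j)) ∧
      rootEdges (row pts p') (Nat.mul 64 p') need lo hi g' g' = true := by
  induction l with
  | nil =>
    intro p g hl _ _ p' hp hp'
    have := List.drop_eq_nil_iff.1 hl.symm
    omega
  | cons c l ih =>
    intro p g hl hg h p' hp hp' hhi
    have hpl : p < pts.length := by omega
    have hc : c = point pts p ∧ l = pts.drop (p + 1) := by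
      rw [List.drop_eq_getElem_cons hpl, List.cons.injEq] at hl
      simpa [point, hpl] using hl
    have step : roots need lo hi pts (c :: l) p g = Bool.rec true
        (Bool.rec false (roots need lo hi pts l (p + 1) (.cons p (row pts p) 0 g))
          (setMask (Nat.sub (Nat.shiftLeft 1 p) 1) g .nil fun g' =>
            rootEdges (row pts p) (Nat.mul 64 p) need lo hi g' g'))
          (Nat.blt (Nat.mul 64 p) hi) := by
      have : roots need lo hi pts (c :: l) p g = forced (Nat.mul 64 p) fun sv =>
        Bool.rec true (
        forced (rowMask c.1 c.2 pts pts) fun r =>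
        forced (Nat.sub (Nat.shiftLeft 1 p) 1) fun P =>
        (Bool.rec false (forced (Nat.succ p) fun p' => roots need lo hi pts l p' (.cons p r 0 g))
          (setMask P g .nil fun g' => rootEdges r sv need lo hi g' g') : Bool))
          (Nat.blt sv hi) := rfl
      rw [this]
      simp only [forced_eq]
      rw [hc.1]
      rfl
    rw [step] at h
    have hlt : Nat.blt (Nat.mul 64 p) hi = true := by
      rw [show Nat.mul 64 p = 64 * p from rfl, Nat.blt_eq]
      omega
    rw [hlt] at h
    obtain ⟨h1, h2⟩ := boolRec_false_eq_true h
    rcases hp.eq_or_lt with rfl | hlt'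
    · obtain ⟨g', h3, h4, -, h5⟩ := setMask_spec (row pts) (Nat.sub (Nat.shiftLeft 1 p) 1) g .nil
      rw [h3] at h1
      refine ⟨g', fun i hi => h4 i (Or.inl (hg i hi)), fun i hi j hj => h5 i j (hg i hi) ?_, h1⟩
      change (1 <<< p - 1).testBit j = true
      rw [Nat.one_shiftLeft, Nat.testBit_two_pow_sub_one]
      simpa using hj
    · refine ih (p + 1) _ hc.2 (fun i hi => ?_) h2 p' hlt' hp' hhi
      rcases (Nat.lt_succ_iff.1 hi).eq_or_lt with rfl | hi
      · exact Or.inl ⟨rfl, rfl⟩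
      · exact Or.inr (hg i hi)

theorem roots_sound {need lo hi : ℕ} {pts : List (ℕ × ℕ)} (hpts : pts.length ≤ 64)
    (h : roots need lo hi pts pts 0 .nil = true) {p q : ℕ} (hp : p < pts.length) (hq : q < p)
    (hlo : lo ≤ 64 * p + q) (hhi : 64 * p + q < hi) {M : Finset (ℕ × ℕ)}
    (hM : IsFamily (row pts) M) (hMp : ∀ e ∈ M, e.1 < p ∧ e.2 < p ∧ e.2 ≠ q ∧
      side (row pts) p q e.1 = true ∧ Compat (row pts) (p, q) e) : M.card < need := by
  obtain ⟨g, h1, h2, h3⟩ := roots_spec pts 0 .nil rfl (by simp) h p (Nat.zero_le _) hp (by omega)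
  have h4 := rootEdges_spec g h3 (h1 q hq) hlo hhi
  obtain ⟨o₁, o₂, h5, -, -, h6⟩ := refineGroup_spec (row pts) p q g .nil .nil
  rw [h5] at h4
  refine search_sound _ _ _ h4 M hM fun e he => ⟨o₁, List.mem_singleton_self _, ?_⟩
  obtain ⟨a1, a2, a3, a4, a5⟩ := hMp e he
  have := h6 e (h2 e.1 a1 e.2 a2) (by omega) (by omega) a3 a5
  rwa [if_pos a4] at this

/-- Twice the signed area of the triangle `pqr`. -/
def cr (p q r : ℝ × ℝ) : ℝ := (q.1 - p.1) * (r.2 - p.2) - (q.2 - p.2) * (r.1 - p.1)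

lemma cr_swap (p q r : ℝ × ℝ) : cr q p r = -cr p q r := by simp only [cr]; ring

lemma cr_rotate (p q r : ℝ × ℝ) : cr q r p = cr p q r := by simp only [cr]; ring

/-- The segments `pq` and `rs` strictly separate each other's endpoints. -/
def Sep (p q r s : ℝ × ℝ) : Prop := cr p q r * cr p q s < 0 ∧ cr r s p * cr r s q < 0

lemma Sep.symm {p q r s : ℝ × ℝ} (h : Sep p q r s) : Sep r s p q := ⟨h.2, h.1⟩

lemma Sep.swap_left {p q r s : ℝ × ℝ} (h : Sep p q r s) : Sep q p r s := by
  refine ⟨?_, by rw [mul_comm]; exact h.2⟩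
  rw [cr_swap p q r, cr_swap p q s, neg_mul_neg]
  exact h.1

lemma Sep.swap_right {p q r s : ℝ × ℝ} (h : Sep p q r s) : Sep p q s r := h.symm.swap_left.symm

lemma Sep.ne {p q r s : ℝ × ℝ} (h : Sep p q r s) : p ≠ r := by
  rintro rfl
  have := h.1
  simp [cr] at this

/-- The point with index `i`, as a point of the plane. -/
def realPoint (pts : List (ℕ × ℕ)) (i : ℕ) : ℝ × ℝ := ((point pts i).1, (point pts i).2)

lemma ccw_iff (pts : List (ℕ × ℕ)) (p a c : ℕ) :
    ccw (point pts p) (point pts a) (point pts c) = true ↔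
      0 < cr (realPoint pts p) (realPoint pts a) (realPoint pts c) := by
  rw [ccw, Nat.blt_eq, ← Nat.cast_lt (α := ℝ), ← sub_pos]
  push_cast
  simp only [cr, realPoint]
  ring_nf

lemma compat_of_sep {pts : List (ℕ × ℕ)} (hpts : pts.length ≤ 64) {e f : ℕ × ℕ}
    (he₁ : e.1 < pts.length) (he₂ : e.2 < pts.length) (hf₁ : f.1 < pts.length)
    (hf₂ : f.2 < pts.length) (h : Sep (realPoint pts e.1) (realPoint pts e.2) (realPoint pts f.1)
      (realPoint pts f.2)) : Compat (row pts) e f := by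
  have key : ∀ {a b : Bool} {x y : ℝ}, (a = true ↔ 0 < x) → (b = true ↔ 0 < y) → x * y < 0 →
      a ≠ b := by
    rintro a b x y ha hb hxy rfl
    rcases mul_neg_iff.1 hxy with ⟨h1, h2⟩ | ⟨h1, h2⟩
    · exact h2.not_gt (hb.1 (ha.2 h1))
    · exact h1.not_gt (ha.1 (hb.2 h2))
  refine ⟨?_, ?_⟩
  · rw [side_row hpts _ he₂ hf₁, side_row hpts _ he₂ hf₂]
    exact key (ccw_iff _ _ _ _) (ccw_iff _ _ _ _) h.1
  · rw [side_row hpts _ he₁ hf₂, side_row hpts _ he₂ hf₂]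
    refine key (ccw_iff _ _ _ _) (ccw_iff _ _ _ _) ?_
    have hcr : ∀ a b c : ℝ × ℝ, cr a b c = -cr a c b := fun a b c => by simp only [cr]; ring
    rw [hcr _ (realPoint pts e.1), hcr _ (realPoint pts e.2), neg_mul_neg]
    exact h.2

theorem card_le_of_sep {need : ℕ} {pts : List (ℕ × ℕ)} (hpts : pts.length ≤ 64)
    (hroots : ∀ p q, q < p → p < pts.length → ∃ lo hi, lo ≤ 64 * p + q ∧ 64 * p + q < hi ∧
      roots need lo hi pts pts 0 .nil = true)
    {M : Finset (ℕ × ℕ)} (h₁ : ∀ e ∈ M, e.1 < pts.length) (h₂ : ∀ e ∈ M, e.2 < pts.length)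
    (hM : ∀ e ∈ M, e.1 ≠ e.2)
    (hsep : ∀ e ∈ M, ∀ f ∈ M, e ≠ f → Sep (realPoint pts e.1) (realPoint pts e.2)
      (realPoint pts f.1) (realPoint pts f.2)) : M.card ≤ need := by
  classical
  rcases M.eq_empty_or_nonempty with rfl | hne
  · simp
  obtain ⟨e₀, he₀, hmax⟩ := M.exists_max_image (fun e => max e.1 e.2) hne
  obtain ⟨p, q, hqp, hor⟩ : ∃ p q, q < p ∧ (e₀ = (p, q) ∨ e₀ = (q, p)) := by
    rcases (hM e₀ he₀).lt_or_gt with h | h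
    · exact ⟨_, _, h, Or.inr rfl⟩
    · exact ⟨_, _, h, Or.inl rfl⟩
  have hp : p < pts.length := by
    rcases hor with rfl | rfl
    · exact h₁ _ he₀
    · exact h₂ _ he₀
  have hsep₀ : ∀ f ∈ M, e₀ ≠ f → Sep (realPoint pts p) (realPoint pts q)
      (realPoint pts f.1) (realPoint pts f.2) := by
    intro f hf hne
    have := hsep e₀ he₀ f hf hne
    rcases hor with rfl | rfl
    · exact this
    · exact this.swap_left
  obtain ⟨lo, hi, hlo, hhi, hr⟩ := hroots p q hqp hp
  let o : ℕ × ℕ → ℕ × ℕ := fun f => if side (row pts) p q f.1 = true then f else f.swap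
  have ho : ∀ f, o f = f ∨ o f = f.swap := fun f => by
    by_cases h : side (row pts) p q f.1 = true <;> simp [o, h]
  have hne' : ∀ a b : ℕ, realPoint pts a ≠ realPoint pts b → a ≠ b := by
    rintro a b h rfl
    exact h rfl
  have hsep' : ∀ e ∈ M, ∀ f ∈ M, e ≠ f → Sep (realPoint pts (o e).1) (realPoint pts (o e).2)
      (realPoint pts (o f).1) (realPoint pts (o f).2) := by
    intro e he f hf hef
    have := hsep e he f hf hef
    rcases ho e with h | h <;> rcases ho f with h' | h' <;> rw [h, h']
    · exact this
    · exact this.swap_right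
    · exact this.swap_left
    · exact this.swap_left.swap_right
  have hlen : ∀ e ∈ M, (o e).1 < pts.length ∧ (o e).2 < pts.length := by
    intro e he
    rcases ho e with h | h <;> rw [h]
    · exact ⟨h₁ e he, h₂ e he⟩
    · exact ⟨h₂ e he, h₁ e he⟩
  have hfam : IsFamily (row pts) ((M.erase e₀).image o) := by
    have hM' : ∀ e ∈ (M.erase e₀).image o, ∃ f ∈ M, e = o f := by
      intro e he
      obtain ⟨f, hf, rfl⟩ := Finset.mem_image.1 he
      exact ⟨f, Finset.mem_of_mem_erase hf, rfl⟩
    have hS : ∀ e ∈ (M.erase e₀).image o, ∀ f ∈ (M.erase e₀).image o, e ≠ f →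
        Sep (realPoint pts e.1) (realPoint pts e.2) (realPoint pts f.1) (realPoint pts f.2) := by
      intro e he f hf hef
      obtain ⟨e, he', rfl⟩ := hM' e he
      obtain ⟨f, hf', rfl⟩ := hM' f hf
      exact hsep' e he' f hf' fun h => hef (congrArg o h)
    have hL : ∀ e ∈ (M.erase e₀).image o, e.1 < pts.length ∧ e.2 < pts.length := by
      intro e he
      obtain ⟨e, he', rfl⟩ := hM' e he
      exact hlen e he'
    exact
      { lt₁ := fun e he => (hL e he).1.trans_le hpts
        lt₂ := fun e he => (hL e he).2.trans_le hpts
        inj₁ := fun e he f hf hef => hne' _ _ (hS e he f hf hef).ne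
        inj₂ := fun e he f hf hef => hne' _ _ (hS e he f hf hef).swap_left.swap_right.ne
        compat := fun e he f hf hef => compat_of_sep hpts (hL e he).1 (hL e he).2 (hL f hf).1
          (hL f hf).2 (hS e he f hf hef) }
  have hcard : ((M.erase e₀).image o).card = M.card - 1 := by
    rw [Finset.card_image_of_injOn, Finset.card_erase_of_mem he₀]
    intro e he f hf hef
    by_contra hne
    refine hne' _ _ (hsep' e (Finset.mem_of_mem_erase he) f (Finset.mem_of_mem_erase hf) hne).ne ?_
    exact congrArg Prod.fst hef
  have := roots_sound hpts hr hp hqp hlo hhi hfam fun e he => by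
    obtain ⟨f, hf, rfl⟩ := Finset.mem_image.1 he
    obtain ⟨hfe, hfM⟩ := Finset.mem_erase.1 hf
    have hs := hsep₀ f hfM hfe.symm
    have hcomp := compat_of_sep (e := (p, q)) hpts hp (hqp.trans hp) (h₁ f hfM) (h₂ f hfM) hs
    have hs' : Sep (realPoint pts p) (realPoint pts q) (realPoint pts (o f).1)
        (realPoint pts (o f).2) := by
      rcases ho f with h | h <;> rw [h]
      · exact hs
      · exact hs.swap_right
    have hmax' := hmax f hfM
    have hpe : max e₀.1 e₀.2 = p := by
      rcases hor with rfl | rfl <;> simp [hqp.le]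
    rw [hpe] at hmax'
    have hne₁ : (o f).1 ≠ p := (hne' _ _ hs'.ne).symm
    have hne₂ : (o f).2 ≠ p := (hne' _ _ hs'.swap_right.ne).symm
    have hlt : (o f).1 ≤ p ∧ (o f).2 ≤ p := by
      have := max_le_iff.1 hmax'
      rcases ho f with h | h <;> rw [h]
      · exact this
      · exact this.symm
    refine ⟨by omega, by omega, (hne' _ _ hs'.swap_left.swap_right.ne).symm, ?_,
      compat_of_sep (e := (p, q)) hpts hp (hqp.trans hp) (hlen f hfM).1 (hlen f hfM).2 hs'⟩
    by_cases h : side (row pts) p q f.1 = true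
    · simp [o, h]
    · have := hcomp.1
      simp only [Bool.not_eq_true] at h
      simp only [o, h]
      simpa [h] using this.symm
  omega

/-- König's theorem: a bipartite graph has a matching and a vertex cover of the same size. -/
theorem exists_matching_cover {α β : Type*} [DecidableEq α] [DecidableEq β] (E : Finset (α × β)) :
    ∃ M ⊆ E, Set.InjOn Prod.fst (M : Set (α × β)) ∧ Set.InjOn Prod.snd (M : Set (α × β)) ∧
      ∃ C : Finset α, ∃ D : Finset β, (∀ e ∈ E, e.1 ∈ C ∨ e.2 ∈ D) ∧ C.card + D.card ≤ M.card := by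
  set A := E.image Prod.fst with hA
  let N : Finset α → Finset β := fun T => (E.filter fun e => e.1 ∈ T).image Prod.snd
  have hN : ∀ T b, b ∈ N T ↔ ∃ a ∈ T, (a, b) ∈ E := by
    intro T b
    simp only [N, Finset.mem_image, Finset.mem_filter, Prod.exists]
    constructor
    · rintro ⟨a, _, ⟨h, h'⟩, rfl⟩
      exact ⟨a, h', h⟩
    · rintro ⟨a, h, h'⟩
      exact ⟨a, b, ⟨h', h⟩, rfl⟩
  obtain ⟨T, hT, hmax⟩ := A.powerset.exists_max_image (fun T => T.card - (N T).card)
    ⟨∅, Finset.empty_mem_powerset A⟩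
  rw [Finset.mem_powerset] at hT
  wlog hle : (N T).card ≤ T.card generalizing T
  · refine this ∅ (Finset.empty_subset _) (fun T' hT' => ?_) (by simp [N])
    have := hmax T' hT'
    omega
  set d := T.card - (N T).card with hd
  let t : A → Finset (β ⊕ Fin d) := fun a => (N {a.1}).disjSum Finset.univ
  obtain ⟨f, hf, hft⟩ := (Finset.all_card_le_biUnion_card_iff_exists_injective t).1 (by
    intro s
    rcases s.eq_empty_or_nonempty with rfl | ⟨a₀, ha₀⟩
    · simp
    have hsub : (N (s.map (Function.Embedding.subtype _))).disjSum (Finset.univ : Finset (Fin d)) ⊆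
        s.biUnion t := by
      intro z hz
      rw [Finset.mem_biUnion]
      rcases z with b | z
      · rw [Finset.inl_mem_disjSum, hN] at hz
        obtain ⟨a, ha, hab⟩ := hz
        obtain ⟨a, ha, rfl⟩ := Finset.mem_map.1 ha
        exact ⟨a, by simpa using ha,
          Finset.inl_mem_disjSum.2 ((hN _ _).2 ⟨_, Finset.mem_singleton_self _, hab⟩)⟩
      · exact ⟨a₀, ha₀, Finset.inr_mem_disjSum.2 (Finset.mem_univ _)⟩
    have := hmax (s.map (Function.Embedding.subtype _)) (by
      rw [Finset.mem_powerset]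
      intro a ha
      obtain ⟨a, -, rfl⟩ := Finset.mem_map.1 ha
      exact a.2)
    refine le_trans ?_ (Finset.card_le_card hsub)
    rw [Finset.card_disjSum, Finset.card_univ, Fintype.card_fin]
    rw [Finset.card_map] at this
    omega)
  let M : Finset (α × β) := E.filter fun e => ∃ h : e.1 ∈ A, f ⟨e.1, h⟩ = Sum.inl e.2
  have hM : ∀ e, e ∈ M ↔ e ∈ E ∧ ∃ h : e.1 ∈ A, f ⟨e.1, h⟩ = Sum.inl e.2 := fun e => by
    simp [M]
  refine ⟨M, Finset.filter_subset _ _, ?_, ?_, A \ T, N T, ?_, ?_⟩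
  · rintro ⟨a, b⟩ he ⟨a', b'⟩ he' h
    obtain ⟨-, h₁, h₂⟩ := (hM _).1 he
    obtain ⟨-, h₁', h₂'⟩ := (hM _).1 he'
    obtain rfl : a = a' := h
    simpa using h₂.symm.trans h₂'
  · rintro ⟨a, b⟩ he ⟨a', b'⟩ he' h
    obtain ⟨-, h₁, h₂⟩ := (hM _).1 he
    obtain ⟨-, h₁', h₂'⟩ := (hM _).1 he'
    obtain rfl : b = b' := h
    simpa using hf (h₂.trans h₂'.symm)
  · rintro ⟨a, b⟩ he
    by_cases ha : a ∈ T
    · exact Or.inr ((hN _ _).2 ⟨a, ha, he⟩)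
    · exact Or.inl (Finset.mem_sdiff.2 ⟨Finset.mem_image_of_mem _ he, ha⟩)
  · have hsub : (Finset.univ.image f) ⊆ (M.image Prod.snd).disjSum Finset.univ := by
      intro z hz
      obtain ⟨a, -, rfl⟩ := Finset.mem_image.1 hz
      have := hft a
      rcases hz : f a with b | z
      · rw [hz, Finset.inl_mem_disjSum, hN] at this
        obtain ⟨a', ha', hab⟩ := this
        rw [Finset.mem_singleton] at ha'
        subst ha'
        exact Finset.inl_mem_disjSum.2 (Finset.mem_image.2 ⟨_, (hM _).2 ⟨hab, a.2, hz⟩, rfl⟩)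
      · exact Finset.inr_mem_disjSum.2 (Finset.mem_univ _)
    have h := Finset.card_le_card hsub
    rw [Finset.card_image_of_injective _ hf, Finset.card_disjSum, Finset.card_univ,
      Fintype.card_coe, Finset.card_univ, Fintype.card_fin] at h
    have := Finset.card_image_le (s := M) (f := Prod.snd)
    have := Finset.card_le_card hT
    rw [Finset.card_sdiff_of_subset hT]
    omega

/-- The points `P (i, j)` are obtained from the points `b i` by replacing each of them by a
cluster of points close to it, nearly on a vertical line. -/
structure IsBlowUp {ι : Type*} {k : ℕ} (b : ι → ℝ × ℝ) (P : ι × Fin k → ℝ × ℝ) : Prop where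
  injective : Function.Injective P
  distinct : ∀ u v w : ι × Fin k, u.1 ≠ v.1 → u.1 ≠ w.1 → v.1 ≠ w.1 →
    0 < cr (b u.1) (b v.1) (b w.1) * cr (P u) (P v) (P w)
  pair : ∀ u v w : ι × Fin k, u.1 = v.1 → u.1 ≠ w.1 → u.2 ≠ v.2 →
    0 < ((v.2 : ℝ) - (u.2 : ℝ)) * ((b u.1).1 - (b w.1).1) * cr (P u) (P v) (P w)
  cluster : ∀ u v w : ι × Fin k, u.1 = v.1 → u.1 = w.1 → u.2 ≠ v.2 → u.2 ≠ w.2 → v.2 ≠ w.2 →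
    cr (P u) (P v) (P w) ≠ 0

theorem exists_isBlowUp {ι : Type*} [Finite ι] (b : ι → ℝ × ℝ)
    (hx : ∀ i j, i ≠ j → (b i).1 ≠ (b j).1)
    (hb : ∀ i j l, i ≠ j → i ≠ l → j ≠ l → cr (b i) (b j) (b l) ≠ 0) (k : ℕ) :
    ∃ P : ι × Fin k → ℝ × ℝ, IsBlowUp b P := by
  let P : ℝ → ι × Fin k → ℝ × ℝ := fun ε u =>
    ((b u.1).1 + ε ^ 2 * (u.2 : ℝ) ^ 2, (b u.1).2 + ε * (u.2 : ℝ))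
  have hpos : ∀ f : ℝ → ℝ, Continuous f → 0 < f 0 → ∀ᶠ ε in nhdsWithin (0 : ℝ) (Set.Ioi 0),
      0 < f ε := fun f hf h0 =>
    (hf.tendsto 0).eventually (lt_mem_nhds h0) |>.filter_mono nhdsWithin_le_nhds
  have hcast : ∀ {a c : Fin k}, a ≠ c → (a : ℝ) - (c : ℝ) ≠ 0 := by
    intro a c h
    rw [sub_ne_zero]
    exact_mod_cast fun h' => h (Fin.ext h')
  have hA : ∀ᶠ ε in nhdsWithin (0 : ℝ) (Set.Ioi 0), ∀ u v w : ι × Fin k,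
      u.1 ≠ v.1 → u.1 ≠ w.1 → v.1 ≠ w.1 →
        0 < cr (b u.1) (b v.1) (b w.1) * cr (P ε u) (P ε v) (P ε w) := by
    simp only [Filter.eventually_all]
    intro u v w huv huw hvw
    refine hpos (fun ε => cr (b u.1) (b v.1) (b w.1) * cr (P ε u) (P ε v) (P ε w)) ?_ ?_
    · simp only [P, cr]
      fun_prop
    · have : ∀ u, P 0 u = b u.1 := fun u => by simp [P]
      simp only [this]
      exact mul_self_pos.2 (hb _ _ _ huv huw hvw)
  have hB : ∀ᶠ ε in nhdsWithin (0 : ℝ) (Set.Ioi 0), ∀ u v w : ι × Fin k,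
      u.1 ≠ w.1 → u.2 ≠ v.2 → 0 < ((v.2 : ℝ) - (u.2 : ℝ)) * ((b u.1).1 - (b w.1).1) *
        (ε * ((v.2 : ℝ) ^ 2 - (u.2 : ℝ) ^ 2) * ((P ε w).2 - (P ε u).2) -
          ((v.2 : ℝ) - (u.2 : ℝ)) * ((P ε w).1 - (P ε u).1)) := by
    simp only [Filter.eventually_all]
    intro u v w huw huv
    refine hpos (fun ε => ((v.2 : ℝ) - (u.2 : ℝ)) * ((b u.1).1 - (b w.1).1) *
        (ε * ((v.2 : ℝ) ^ 2 - (u.2 : ℝ) ^ 2) * ((P ε w).2 - (P ε u).2) -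
          ((v.2 : ℝ) - (u.2 : ℝ)) * ((P ε w).1 - (P ε u).1))) ?_ ?_
    · simp only [P]
      fun_prop
    · have := mul_self_pos.2 (mul_ne_zero (hcast huv.symm) (sub_ne_zero.2 (hx _ _ huw)))
      simp only [P]
      ring_nf at this ⊢
      exact this
  have hC : ∀ᶠ ε in nhdsWithin (0 : ℝ) (Set.Ioi 0), ∀ u v : ι × Fin k, u.1 ≠ v.1 →
      0 < ((b u.1).1 - (b v.1).1) * ((P ε u).1 - (P ε v).1) := by
    simp only [Filter.eventually_all]
    intro u v huv
    refine hpos (fun ε => ((b u.1).1 - (b v.1).1) * ((P ε u).1 - (P ε v).1)) ?_ ?_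
    · simp only [P]
      fun_prop
    · have : ∀ u, P 0 u = b u.1 := fun u => by simp [P]
      simp only [this]
      exact mul_self_pos.2 (sub_ne_zero.2 (hx _ _ huv))
  obtain ⟨ε, ⟨⟨hA, hB⟩, hC⟩, hε⟩ := (((hA.and hB).and hC).and self_mem_nhdsWithin).exists
  replace hε : 0 < ε := hε
  refine ⟨P ε, fun u v huv => ?_, hA, fun u v w huv huw h => ?_, fun u v w huv huw h₁ h₂ h₃ => ?_⟩
  · by_cases h₁ : u.1 = v.1
    · have h := congrArg Prod.snd huv
      simp only [P, h₁, add_right_inj, mul_eq_mul_left_iff, hε.ne', or_false, Nat.cast_inj] at h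
      exact Prod.ext h₁ (Fin.ext h)
    · have h := hC u v h₁
      rw [huv, sub_self, mul_zero] at h
      exact absurd h (lt_irrefl _)
  · have hcr : cr (P ε u) (P ε v) (P ε w) =
        ε * (ε * ((v.2 : ℝ) ^ 2 - (u.2 : ℝ) ^ 2) * ((P ε w).2 - (P ε u).2) -
          ((v.2 : ℝ) - (u.2 : ℝ)) * ((P ε w).1 - (P ε u).1)) := by
      simp only [P, cr, ← huv]
      ring
    rw [hcr, mul_left_comm]
    exact mul_pos hε (hB u v w huw h)
  · have : cr (P ε u) (P ε v) (P ε w) = ε ^ 3 * (((v.2 : ℝ) - (u.2 : ℝ)) *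
        ((w.2 : ℝ) - (u.2 : ℝ)) * ((v.2 : ℝ) - (w.2 : ℝ))) := by
      simp only [P, cr, ← huv, ← huw]
      ring
    rw [this]
    exact mul_ne_zero (pow_pos hε 3).ne'
      (mul_ne_zero (mul_ne_zero (hcast h₁.symm) (hcast h₂.symm)) (hcast h₃))

namespace IsBlowUp

variable {ι : Type*} {k : ℕ} {b : ι → ℝ × ℝ} {P : ι × Fin k → ℝ × ℝ}

lemma cr_ne_zero (h : IsBlowUp b P) {u v w : ι × Fin k} (huv : u ≠ v) (huw : u ≠ w)
    (hvw : v ≠ w) : cr (P u) (P v) (P w) ≠ 0 := by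
  have hsnd : ∀ {u v : ι × Fin k}, u ≠ v → u.1 = v.1 → u.2 ≠ v.2 := fun hne h₁ h₂ =>
    hne (Prod.ext h₁ h₂)
  by_cases h₁ : u.1 = v.1
  · by_cases h₂ : u.1 = w.1
    · exact h.cluster u v w h₁ h₂ (hsnd huv h₁) (hsnd huw h₂) (hsnd hvw (h₁.symm.trans h₂))
    · exact right_ne_zero_of_mul (h.pair u v w h₁ h₂ (hsnd huv h₁)).ne'
  · by_cases h₂ : u.1 = w.1
    · rw [← cr_rotate, ← cr_rotate]
      exact right_ne_zero_of_mul
        (h.pair w u v h₂.symm (fun h => h₁ (h₂.trans h)) (hsnd huw h₂).symm).ne'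
    · by_cases h₃ : v.1 = w.1
      · rw [← cr_rotate]
        exact right_ne_zero_of_mul (h.pair v w u h₃ (Ne.symm h₁) (hsnd hvw h₃)).ne'
      · exact right_ne_zero_of_mul (h.distinct u v w h₁ h₂ h₃).ne'

lemma _root_.CrossingSearch.mul_pos_of_mul_pos {a x y : ℝ} (hx : 0 < a * x) (hy : 0 < a * y) :
    0 < x * y := by
  have h : 0 < a ^ 2 * (x * y) := by
    have := mul_pos hx hy
    linarith [mul_mul_mul_comm a x a y]
  exact pos_of_mul_pos_right h (sq_nonneg a)

lemma cr_mul_cr_pos (h : IsBlowUp b P) {u v w w' : ι × Fin k} (huv : u ≠ v) (hw : w.1 = w'.1)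
    (hu : u.1 ≠ w.1) (hv : v.1 ≠ w.1) : 0 < cr (P u) (P v) (P w) * cr (P u) (P v) (P w') := by
  by_cases h₁ : u.1 = v.1
  · have h₂ : u.2 ≠ v.2 := fun h₂ => huv (Prod.ext h₁ h₂)
    refine mul_pos_of_mul_pos (h.pair u v w h₁ hu h₂) ?_
    rw [hw]
    exact h.pair u v w' h₁ (hw ▸ hu) h₂
  · refine mul_pos_of_mul_pos (h.distinct u v w h₁ hu hv) ?_
    rw [hw]
    exact h.distinct u v w' h₁ (hw ▸ hu) (hw ▸ hv)

lemma fst_eq_of_sep (h : IsBlowUp b P) {e f : (ι × Fin k) × (ι × Fin k)} (he : e.1.1 = e.2.1)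
    (hf : f.1 ≠ f.2) (hs : Sep (P e.1) (P e.2) (P f.1) (P f.2)) :
    f.1.1 = e.1.1 ∨ f.2.1 = e.1.1 := by
  by_contra! hne
  exact hs.2.not_gt (h.cr_mul_cr_pos hf he hne.1 hne.2)

lemma fst_ne_of_sep (h : IsBlowUp b P) {u v w z : ι × Fin k} (huv : (b u.1).1 < (b v.1).1)
    (hwz : (b w.1).1 < (b z.1).1) (hs : Sep (P u) (P v) (P w) (P z)) : u.1 ≠ z.1 := by
  intro huz
  have huz' : u.2 ≠ z.2 := fun h₂ => hs.swap_right.ne (congrArg P (Prod.ext huz h₂))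
  have hne : ∀ {i j : ι}, (b i).1 < (b j).1 → i ≠ j := by
    rintro i j hij rfl
    exact lt_irrefl _ hij
  have huv' := hne huv
  have huw' : u.1 ≠ w.1 := huz ▸ (hne hwz).symm
  have hvw' : v.1 ≠ w.1 := (hne ((huz ▸ hwz).trans huv)).symm
  have h₁ : 0 < ((z.2 : ℝ) - u.2) * cr (P u) (P v) (P z) := by
    have e : cr (P u) (P v) (P z) = -cr (P u) (P z) (P v) := by simp only [cr]; ring
    have := h.pair u z v huz huv' huz'
    rw [e]
    rw [mul_right_comm] at this
    linarith [neg_of_mul_pos_left this (sub_neg.2 huv).le]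
  have h₂ : 0 < ((z.2 : ℝ) - u.2) * cr (P u) (P z) (P w) := by
    have := h.pair u z w huz huw' huz'
    rw [mul_right_comm] at this
    exact pos_of_mul_pos_left this (sub_pos.2 (huz ▸ hwz)).le
  have h₃ : 0 < cr (P w) (P z) (P v) * cr (P u) (P v) (P w) := by
    have := h.cr_mul_cr_pos (u := v) (v := w) (fun h' => hvw' (congrArg Prod.fst h')) huz.symm
      (huz ▸ huv'.symm) (hne hwz)
    rwa [← cr_rotate (P v) (P w) (P z), cr_rotate (P u) (P v) (P w)] at this
  have h₄ : 0 < cr (P w) (P z) (P v) * cr (P u) (P z) (P w) := by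
    have e : cr (P w) (P z) (P u) = -cr (P u) (P z) (P w) := by simp only [cr]; ring
    have := hs.2
    rw [e] at this
    linarith
  have h₅ := mul_pos_of_mul_pos h₃ h₄
  have h₆ := mul_pos_of_mul_pos h₁ h₂
  have h₇ : 0 < cr (P u) (P v) (P w) * -cr (P u) (P v) (P z) := by linarith [hs.1]
  linarith [mul_pos_of_mul_pos h₇ h₅]

theorem card_le_of_cover {F : Finset ((ι × Fin k) × (ι × Fin k))}
    (hsep : ∀ e ∈ F, ∀ f ∈ F, e ≠ f → Sep (P e.1) (P e.2) (P f.1) (P f.2)) (C : Finset ι)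
    (hC : ∀ e ∈ F, e.1.1 ∈ C ∨ e.2.1 ∈ C) : F.card ≤ C.card * k := by
  classical
  let g : (ι × Fin k) × (ι × Fin k) → ι × Fin k := fun e => if e.1.1 ∈ C then e.1 else e.2
  have hg : ∀ e, g e = e.1 ∨ g e = e.2 := fun e => by
    by_cases h : e.1.1 ∈ C <;> simp [g, h]
  have := Finset.card_le_card_of_injOn (s := F) (t := C ×ˢ (Finset.univ : Finset (Fin k))) g
    (fun e he => by
      rw [Finset.coe_product]
      refine ⟨?_, by simp⟩
      by_cases h : e.1.1 ∈ C
      · simp [g, h]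
      · simpa [g, h] using hC e he)
    (fun e he f hf hef => by
      by_contra hne
      have hs := hsep e he f hf hne
      have hP := congrArg P hef
      rcases hg e with h₁ | h₁ <;> rcases hg f with h₂ | h₂ <;> rw [h₁, h₂] at hP
      · exact hs.ne hP
      · exact hs.swap_right.ne hP
      · exact hs.swap_left.ne hP
      · exact hs.swap_left.swap_right.ne hP)
  simpa using this

theorem card_le (h : IsBlowUp b P) (hx : ∀ i j, i ≠ j → (b i).1 ≠ (b j).1) {c : ℕ} (hc : 0 < c)
    (hb : ∀ M : Finset (ι × ι), (∀ e ∈ M, e.1 ≠ e.2) →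
      (∀ e ∈ M, ∀ f ∈ M, e ≠ f → Sep (b e.1) (b e.2) (b f.1) (b f.2)) → M.card ≤ c)
    {F : Finset ((ι × Fin k) × (ι × Fin k))} (hF : ∀ e ∈ F, e.1 ≠ e.2)
    (hsep : ∀ e ∈ F, ∀ f ∈ F, e ≠ f → Sep (P e.1) (P e.2) (P f.1) (P f.2)) :
    F.card ≤ c * k := by
  classical
  by_cases hin : ∃ e ∈ F, e.1.1 = e.2.1
  · obtain ⟨e, he, hee⟩ := hin
    refine (card_le_of_cover hsep {e.1.1} fun f hf => ?_).trans
      (Nat.mul_le_mul_right k (by simpa using Nat.succ_le_of_lt hc))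
    rcases eq_or_ne e f with rfl | hef
    · simp
    · simpa using h.fst_eq_of_sep hee (hF f hf) (hsep e he f hf hef)
  push Not at hin
  let o : (ι × Fin k) × (ι × Fin k) → (ι × Fin k) × (ι × Fin k) := fun e =>
    if (b e.1.1).1 < (b e.2.1).1 then e else e.swap
  have ho : ∀ e, o e = e ∨ o e = e.swap := fun e => by
    by_cases h : (b e.1.1).1 < (b e.2.1).1 <;> simp [o, h]
  have hlt : ∀ e ∈ F, (b (o e).1.1).1 < (b (o e).2.1).1 := fun e he => by
    by_cases h : (b e.1.1).1 < (b e.2.1).1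
    · simp [o, h]
    · simpa [o, h] using lt_of_le_of_ne (not_lt.1 h) (hx _ _ (hin e he)).symm
  have hsep' : ∀ e ∈ F, ∀ f ∈ F, e ≠ f →
      Sep (P (o e).1) (P (o e).2) (P (o f).1) (P (o f).2) := fun e he f hf hef => by
    have := hsep e he f hf hef
    rcases ho e with h₁ | h₁ <;> rcases ho f with h₂ | h₂ <;> rw [h₁, h₂]
    · exact this
    · exact this.swap_right
    · exact this.swap_left
    · exact this.swap_left.swap_right
  have hne : ∀ e ∈ F, ∀ f ∈ F, (o e).1.1 ≠ (o f).2.1 := fun e he f hf => by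
    rcases eq_or_ne e f with rfl | hef
    · intro h'
      exact (hlt e he).ne (congrArg (fun i => (b i).1) h')
    · exact h.fst_ne_of_sep (hlt e he) (hlt f hf) (hsep' e he f hf hef)
  obtain ⟨M, hME, hM₁, hM₂, C, D, hCD, hcard⟩ :=
    exists_matching_cover (F.image fun e => ((o e).1.1, (o e).2.1))
  have hMF : ∀ e ∈ M, ∃ f ∈ F, ((o f).1.1, (o f).2.1) = e := fun e he =>
    Finset.mem_image.1 (hME he)
  have hMc : M.card ≤ c := by
    refine hb M (fun e he => ?_) (fun e he f hf hef => ?_)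
    · obtain ⟨f, hf, rfl⟩ := hMF e he
      exact hne f hf f hf
    · have h₁ : e.1 ≠ f.1 := fun h' => hef (hM₁ he hf h')
      have h₂ : e.2 ≠ f.2 := fun h' => hef (hM₂ he hf h')
      obtain ⟨e, he', rfl⟩ := hMF e he
      obtain ⟨f, hf', rfl⟩ := hMF f hf
      have hs := hsep' e he' f hf' fun h' => hef (by rw [h'])
      have key : ∀ u v w z : ι × Fin k, u.1 ≠ v.1 → u.1 ≠ w.1 → u.1 ≠ z.1 → v.1 ≠ w.1 →
          v.1 ≠ z.1 → cr (P u) (P v) (P w) * cr (P u) (P v) (P z) < 0 →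
          cr (b u.1) (b v.1) (b w.1) * cr (b u.1) (b v.1) (b z.1) < 0 := by
        intro u v w z huv huw huz hvw hvz hneg
        have := mul_pos (h.distinct u v w huv huw hvw) (h.distinct u v z huv huz hvz)
        rw [mul_mul_mul_comm] at this
        exact neg_of_mul_pos_left this hneg.le
      exact ⟨key _ _ _ _ (hne _ he' _ he') h₁ (hne _ he' _ hf') (hne _ hf' _ he').symm h₂ hs.1,
        key _ _ _ _ (hne _ hf' _ hf') h₁.symm (hne _ hf' _ he') (hne _ he' _ hf').symm h₂.symm hs.2⟩
  refine (card_le_of_cover hsep (C ∪ D) fun e he => ?_).trans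
    (Nat.mul_le_mul_right k ((Finset.card_union_le C D).trans (hcard.trans hMc)))
  have := hCD _ (Finset.mem_image_of_mem _ he)
  simp only [Finset.mem_union]
  rcases ho e with h' | h' <;> rw [h'] at this <;>
    simp only [Prod.fst_swap, Prod.snd_swap] at this <;> tauto

end IsBlowUp

lemma cr_combo (p q r s : ℝ × ℝ) {α β : ℝ} (h : α + β = 1) :
    cr p q (α • r + β • s) = α * cr p q r + β * cr p q s := by
  obtain rfl : α = 1 - β := by linarith
  simp only [cr, Prod.fst_add, Prod.snd_add, Prod.smul_fst, Prod.smul_snd, smul_eq_mul]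
  ring

lemma cr_eq_zero_of_collinear {p q r : ℝ × ℝ} (h : Collinear ℝ ({p, q, r} : Set (ℝ × ℝ))) :
    cr p q r = 0 := by
  obtain ⟨v, hv⟩ := (collinear_iff_of_mem (p₀ := p) (by simp)).1 h
  obtain ⟨s, rfl⟩ := hv q (by simp)
  obtain ⟨t, rfl⟩ := hv r (by simp)
  simp only [cr, vadd_eq_add, Prod.fst_add, Prod.snd_add, Prod.smul_fst, Prod.smul_snd,
    smul_eq_mul]
  ring

lemma cr_mul_cr_neg_of_crosses {p q r s : ℝ × ℝ} (h : Crosses p q r s) (hpq : p ≠ q) (hrs : r ≠ s)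
    (hr : r ≠ p → r ≠ q → cr p q r ≠ 0) (hs : s ≠ p → s ≠ q → cr p q s ≠ 0) :
    cr p q r * cr p q s < 0 := by
  obtain ⟨x, ⟨a, c, ha, hc, hac, rfl⟩, ⟨a', c', ha', hc', hac', hx⟩, hsing⟩ := h
  have h0 : a' * cr p q r + c' * cr p q s = 0 := by
    rw [← cr_combo p q r s hac', hx, cr_combo p q p q hac]
    simp only [cr]
    ring
  have hne : cr p q r ≠ 0 := by
    intro hr0
    have hs0 : cr p q s = 0 := by
      rw [hr0, mul_zero, zero_add] at h0
      exact (mul_eq_zero.1 h0).resolve_left hc'.ne'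
    have hr' : r = p ∨ r = q := by
      by_contra! h'
      exact hr h'.1 h'.2 hr0
    have hs' : s = p ∨ s = q := by
      by_contra! h'
      exact hs h'.1 h'.2 hs0
    have hseg : segment ℝ r s = segment ℝ p q := by
      rcases hr' with rfl | rfl <;> rcases hs' with rfl | rfl
      · exact absurd rfl hrs
      · rfl
      · exact segment_symm ℝ r s
      · exact absurd rfl hrs
    rw [hseg, Set.inter_self] at hsing
    have h₁ := left_mem_segment ℝ p q
    have h₂ := right_mem_segment ℝ p q
    rw [hsing, Set.mem_singleton_iff] at h₁ h₂
    exact hpq (h₁.trans h₂.symm)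
  have hsq : 0 < a' * (cr p q r) ^ 2 := by positivity
  have : c' * (cr p q r * cr p q s) = -(a' * (cr p q r) ^ 2) := by linear_combination cr p q r * h0
  exact neg_of_mul_neg_right (by linarith) hc'.le

lemma sep_of_crosses {p q r s : ℝ × ℝ} (h : Crosses p q r s) (hpq : p ≠ q) (hrs : r ≠ s)
    (hr : r ≠ p → r ≠ q → cr p q r ≠ 0) (hs : s ≠ p → s ≠ q → cr p q s ≠ 0)
    (hp : p ≠ r → p ≠ s → cr r s p ≠ 0) (hq : q ≠ r → q ≠ s → cr r s q ≠ 0) : Sep p q r s :=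
  ⟨cr_mul_cr_neg_of_crosses h hpq hrs hr hs, cr_mul_cr_neg_of_crosses
    (by obtain ⟨x, h₁, h₂, h₃⟩ := h; exact ⟨x, h₂, h₁, Set.inter_comm _ _ ▸ h₃⟩) hrs hpq hp hq⟩

/-- If the pairwise crossing families of the points `b i` have size at most `c`, then sets of `n`
points in general position without larger crossing families than `c * k` exist for all
`n ≤ card ι * k`. -/
theorem exists_cf_le {ι : Type*} [Fintype ι] (b : ι → ℝ × ℝ)
    (hx : ∀ i j, i ≠ j → (b i).1 ≠ (b j).1)
    (hcr : ∀ i j l, i ≠ j → i ≠ l → j ≠ l → cr (b i) (b j) (b l) ≠ 0) {c : ℕ} (hc : 0 < c)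
    (hb : ∀ M : Finset (ι × ι), (∀ e ∈ M, e.1 ≠ e.2) →
      (∀ e ∈ M, ∀ f ∈ M, e ≠ f → Sep (b e.1) (b e.2) (b f.1) (b f.2)) → M.card ≤ c)
    {n k : ℕ} (hn : n ≤ Fintype.card ι * k) :
    ∃ S : Finset (ℝ × ℝ), S.card = n ∧ GenPos S ∧ cf S ≤ c * k := by
  classical
  obtain ⟨P, hP⟩ := exists_isBlowUp b hx hcr k
  obtain ⟨S, hS, hcard⟩ := Finset.exists_subset_card_eq (s := Finset.univ.image P) (n := n) (by
    rwa [Finset.card_image_of_injective _ hP.injective, Finset.card_univ, Fintype.card_prod,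
      Fintype.card_fin])
  have hS' : ∀ p ∈ S, ∃ u, P u = p := fun p hp => by simpa using hS hp
  have hne : ∀ u v w, P w ≠ P u → P w ≠ P v → P u ≠ P v → cr (P u) (P v) (P w) ≠ 0 :=
    fun u v w h₁ h₂ h₃ => hP.cr_ne_zero (fun h => h₃ (congrArg P h))
      (fun h => h₁ (congrArg P h).symm) (fun h => h₂ (congrArg P h).symm)
  refine ⟨S, hcard, fun p hp q hq r hr hpq hpr hqr hcol => ?_, ?_⟩
  · obtain ⟨u, rfl⟩ := hS' p hp
    obtain ⟨v, rfl⟩ := hS' q hq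
    obtain ⟨w, rfl⟩ := hS' r hr
    exact hne u v w hpr.symm hqr.symm hpq (cr_eq_zero_of_collinear hcol)
  refine csSup_le ⟨0, ∅, by simp [IsCrossingFamily], rfl⟩ ?_
  rintro _ ⟨F, ⟨hF, hcross⟩, rfl⟩
  let F' : Finset ((ι × Fin k) × (ι × Fin k)) := {e | (P e.1, P e.2) ∈ F}
  have hF' : ∀ e, e ∈ F' ↔ (P e.1, P e.2) ∈ F := fun e => by simp [F']
  have hsub : F ⊆ F'.image fun e => (P e.1, P e.2) := by
    rintro ⟨p, q⟩ he
    obtain ⟨hp, hq, -⟩ := hF _ he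
    obtain ⟨u, rfl⟩ := hS' p hp
    obtain ⟨v, rfl⟩ := hS' q hq
    exact Finset.mem_image.2 ⟨(u, v), (hF' _).2 he, rfl⟩
  refine (Finset.card_le_card hsub).trans (Finset.card_image_le.trans ?_)
  refine hP.card_le hx hc hb (fun e he h => ?_) (fun e he f hf hef => ?_)
  · exact (hF _ ((hF' e).1 he)).2.2 (congrArg P h)
  · have he' := (hF' e).1 he
    have hf' := (hF' f).1 hf
    have h₁ := (hF _ he').2.2
    have h₂ := (hF _ hf').2.2
    refine sep_of_crosses (hcross _ he' _ hf' fun h => hef ?_) h₁ h₂ ?_ ?_ ?_ ?_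
    · obtain ⟨h, h'⟩ := Prod.mk.inj h
      exact Prod.ext (hP.injective h) (hP.injective h')
    · exact fun h h' => hne _ _ _ h h' h₁
    · exact fun h h' => hne _ _ _ h h' h₁
    · exact fun h h' => hne _ _ _ h h' h₂
    · exact fun h h' => hne _ _ _ h h' h₂

/-- Whether any three points of the list in this order are not collinear. -/
def noCollinear : List (ℕ × ℕ) → Bool
  | [] => true
  | p :: l => decide (l.Pairwise fun a c => p.2 * a.1 + (a.2 * c.1 + c.2 * p.1) ≠
      p.1 * a.2 + (a.1 * c.2 + c.1 * p.2)) && noCollinear l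

lemma noCollinear_spec {l : List (ℕ × ℕ)} (h : noCollinear l = true) :
    l.Triplewise fun p a c => p.2 * a.1 + (a.2 * c.1 + c.2 * p.1) ≠
      p.1 * a.2 + (a.1 * c.2 + c.1 * p.2) := by
  induction l with
  | nil => exact .nil
  | cons p l ih =>
    rw [noCollinear, Bool.and_eq_true, decide_eq_true_eq] at h
    exact .cons h.1 (ih h.2)

lemma cr_realPoint_ne_zero {pts : List (ℕ × ℕ)} (h : noCollinear pts = true) {i j l : ℕ}
    (hi : i < pts.length) (hj : j < pts.length) (hl : l < pts.length) (hij : i ≠ j) (hil : i ≠ l)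
    (hjl : j ≠ l) : cr (realPoint pts i) (realPoint pts j) (realPoint pts l) ≠ 0 := by
  have key : ∀ {i j l : ℕ}, i < j → j < l → l < pts.length →
      cr (realPoint pts i) (realPoint pts j) (realPoint pts l) ≠ 0 := by
    intro i j l hij hjl hl h0
    refine List.triplewise_iff_getElem.1 (noCollinear_spec h) i j l hij hjl hl ?_
    have hp : ∀ i (hi : i < pts.length), realPoint pts i = ((pts[i].1 : ℝ), (pts[i].2 : ℝ)) := by
      intro i hi
      simp [realPoint, point, hi]
    rw [hp i (by omega), hp j (by omega), hp l hl, cr] at h0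
    rw [← Nat.cast_inj (R := ℝ)]
    push_cast
    linear_combination -h0
  have hrot := cr_rotate (realPoint pts i) (realPoint pts j) (realPoint pts l)
  have hrot' := cr_rotate (realPoint pts j) (realPoint pts l) (realPoint pts i)
  have hswap : ∀ p q r : ℝ × ℝ, cr q p r ≠ 0 → cr p q r ≠ 0 := fun p q r h => by
    rwa [cr_swap q p r, neg_ne_zero]
  rcases hij.lt_or_gt with h₁ | h₁ <;> rcases hil.lt_or_gt with h₂ | h₂ <;>
    rcases hjl.lt_or_gt with h₃ | h₃ <;> try omega
  · exact key h₁ h₃ hl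
  · rw [← hrot, ← hrot']
    exact hswap _ _ _ (key h₂ h₃ hj)
  · rw [← hrot, ← hrot']
    exact key h₂ h₁ hj
  · exact hswap _ _ _ (key h₁ h₂ hl)
  · rw [← hrot]
    exact key h₃ h₂ hi
  · rw [← hrot]
    exact hswap _ _ _ (key h₃ h₁ hi)

/-- A configuration of 41 points without 9 pairwise crossing segments. -/
def configPts : List (ℕ × ℕ) :=
  [(321076153, 241262049), (154836738, 327024497), (28308116, 43319548), (298130177, 235312136),
   (177732975, 228755474), (177206792, 228084431), (183005463, 224200695), (174993934, 229657342),
   (178734729, 217159963), (168101258, 212220222), (168037725, 212719814), (173826856, 220908044),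
   (173795941, 221078145), (331054259, 246260111), (183952121, 225188764), (168239894, 226652364),
   (167086447, 217274956), (166766925, 217227841), (150406387, 346774933), (165319007, 212457290),
   (301080695, 235565627), (183077385, 220669997), (162175237, 318760831), (166558253, 292319737),
   (167351169, 294771543), (294718516, 234792435), (269979400, 228860903), (358358968, 251003798),
   (342225304, 248381561), (42248881, 56726542), (54182247, 77837953), (51140879, 72986637),
   (73360591, 112176448), (74905091, 114003776), (86529609, 122103651), (1, 1),
   (138186563, 389144257), (144984300, 360817817), (128586176, 418314191), (168495506, 225866109),
   (178887998, 216540955)]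

lemma configPts_fst : configPts.Pairwise fun p q => p.1 ≠ q.1 := by decide +kernel

lemma configPts_noCollinear : noCollinear configPts = true := by decide +kernel

lemma roots_configPts_0 : roots 8 0 2432 configPts configPts 0 .nil = true := by
  decide +kernel

lemma roots_configPts_2432 : roots 8 2432 2520 configPts configPts 0 .nil = true := by
  decide +kernel

lemma roots_configPts_2520 : roots 8 2520 2560 configPts configPts 0 .nil = true := by
  decide +kernel

lemma roots_configPts_2560 : roots 8 2560 2585 configPts configPts 0 .nil = true := by
  decide +kernel

lemma roots_configPts_2585 : roots 8 2585 2624 configPts configPts 0 .nil = true := by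
  decide +kernel

theorem configPts_card_le {M : Finset (ℕ × ℕ)} (h₁ : ∀ e ∈ M, e.1 < 41) (h₂ : ∀ e ∈ M, e.2 < 41)
    (hM : ∀ e ∈ M, e.1 ≠ e.2) (hsep : ∀ e ∈ M, ∀ f ∈ M, e ≠ f → Sep (realPoint configPts e.1)
      (realPoint configPts e.2) (realPoint configPts f.1) (realPoint configPts f.2)) :
    M.card ≤ 8 := by
  refine card_le_of_sep (pts := configPts) (by decide) (fun p q hqp hp => ?_) h₁ h₂ hM hsep
  replace hp : p < 41 := hp
  rcases lt_or_ge (64 * p + q) 2432 with h1 | h1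
  · exact ⟨_, _, by omega, h1, roots_configPts_0⟩
  rcases lt_or_ge (64 * p + q) 2520 with h2 | h2
  · exact ⟨_, _, by omega, h2, roots_configPts_2432⟩
  rcases lt_or_ge (64 * p + q) 2560 with h3 | h3
  · exact ⟨_, _, by omega, h3, roots_configPts_2520⟩
  rcases lt_or_ge (64 * p + q) 2585 with h4 | h4
  · exact ⟨_, _, by omega, h4, roots_configPts_2560⟩
  exact ⟨_, _, h4, by omega, roots_configPts_2585⟩

theorem exists_cf_le_of_le {n k : ℕ} (hn : n ≤ 41 * k) :
    ∃ S : Finset (ℝ × ℝ), S.card = n ∧ GenPos S ∧ cf S ≤ 8 * k := by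
  refine exists_cf_le (fun i : Fin 41 => realPoint configPts i) (fun i j hij => ?_)
    (fun i j l hij hil hjl => ?_) (by norm_num) (fun M hM hsep => ?_) (by simpa using hn)
  · have hfst : ∀ i j : Fin 41, i < j → (realPoint configPts i).1 ≠ (realPoint configPts j).1 := by
      intro i j hij h
      have hij' := List.pairwise_iff_getElem.1 configPts_fst i j i.2 j.2 hij
      refine hij' ?_
      have hp : ∀ i : Fin 41, point configPts i = configPts[i.1]'i.2 := fun i =>
        List.getD_eq_getElem _ _ i.2
      simpa only [realPoint, Nat.cast_inj, hp] using h
    rcases hij.lt_or_gt with h | h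
    · exact hfst i j h
    · exact (hfst j i h).symm
  · exact cr_realPoint_ne_zero configPts_noCollinear i.2 j.2 l.2 (Fin.val_ne_of_ne hij)
      (Fin.val_ne_of_ne hil) (Fin.val_ne_of_ne hjl)
  · rw [← Finset.card_map (Fin.valEmbedding.prodMap Fin.valEmbedding)]
    have hmem : ∀ e ∈ M.map (Fin.valEmbedding.prodMap Fin.valEmbedding),
        ∃ f ∈ M, e = ((f.1 : ℕ), (f.2 : ℕ)) := by
      intro e he
      obtain ⟨f, hf, rfl⟩ := Finset.mem_map.1 he
      exact ⟨f, hf, rfl⟩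
    refine configPts_card_le (fun e he => ?_) (fun e he => ?_) (fun e he => ?_)
      (fun e he f hf hef => ?_) <;> obtain ⟨e, he', rfl⟩ := hmem e he
    · exact e.1.2
    · exact e.2.2
    · exact Fin.val_ne_of_ne (hM e he')
    · obtain ⟨f, hf', rfl⟩ := hmem f hf
      exact hsep e he' f hf' fun h => hef (by rw [h])

end CrossingSearch

/-- For every positive integer `n`, `cf(n) ≤ 8 * ⌈n / 41⌉`: there exists a set
of `n` points in the plane in general position whose largest crossing family
has size at most `8 * ⌈n / 41⌉`. -/
theorem cfNat_le_8_mul_ceilDiv_41 (n : ℕ) (hn : 0 < n) :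
    cfNat n ≤ 8 * (n ⌈/⌉ 41) ∧
    ∃ S : Finset (ℝ × ℝ), S.card = n ∧ GenPos S ∧ cf S ≤ 8 * (n ⌈/⌉ 41) := by
  have hle : n ≤ 41 * (n ⌈/⌉ 41) := (ceilDiv_le_iff_le_mul (by norm_num)).1 le_rfl
  obtain ⟨S, hS, hgen, hcf⟩ := CrossingSearch.exists_cf_le_of_le hle
  have hmin : cfNat n ≤ cf S := Nat.sInf_le ⟨S, hS, hgen, rfl⟩
  exact ⟨hmin.trans hcf, S, hS, hgen, hcf⟩
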